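/- arXiv:2012.07670 — 8 statements merged into one kernel-verified Lean document; each statement's English description precedes it below -/
import Mathlib

section
/- Let n ≥ 2, 1 ≤ k ≤ n, and let A be a real symmetric n×n matrix with λ(A) ∈ Γ_k. Let S_k'(A) be the unique real symmetric n×n matrix such that (d/dt)|_{t=0} S_k(A + tB) = trace(S_k'(A)·B) for every real symmetric n×n matrix B (its entries are the partial derivatives S_k^{ij}(A)). Then S_k'(A) is positive definite, λ(S_k'(A)) ∈ Γ_k^*, and ρ_k^*(λ(S_k'(A))) = (k/n)·C(n,k)^{1/k}·S_k(A)^{(k−1)/k}. -/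
/-- The `j`-th elementary symmetric polynomial of `lam ∈ ℝⁿ`. -/
noncomputable def sigmaE {n : ℕ} (j : ℕ) (lam : Fin n → ℝ) : ℝ :=
  ∑ s ∈ Finset.powersetCard j Finset.univ, ∏ i ∈ s, lam i

/-- The Gårding cone `Γ_k = {λ ∈ ℝⁿ : σ_j(λ) > 0 for j = 1,…,k}`. -/
def GardingCone (n k : ℕ) : Set (Fin n → ℝ) :=
  {lam | ∀ j, 1 ≤ j → j ≤ k → 0 < sigmaE j lam}

open scoped Classical in
/-- `S_k(A) = σ_k(λ(A))` for a Hermitian (= real symmetric) matrix `A`. -/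
noncomputable def SkM {n : ℕ} (k : ℕ) (A : Matrix (Fin n) (Fin n) ℝ) : ℝ :=
  if hA : A.IsHermitian then sigmaE k hA.eigenvalues else 0

/-- The dual Gårding cone `Γ_k^*`. -/
def GardingDual (n k : ℕ) : Set (Fin n → ℝ) :=
  {lam | ∀ mu ∈ GardingCone n k, 0 ≤ ∑ i, lam i * mu i}

/-- `ρ_k^*(λ) = inf{(λ·μ)/n : μ ∈ Γ_k, σ_k(μ) ≥ C(n,k)}`. -/
noncomputable def rhoStar (n k : ℕ) (lam : Fin n → ℝ) : ℝ :=
  sInf {r : ℝ | ∃ mu : Fin n → ℝ, mu ∈ GardingCone n k ∧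
    (n.choose k : ℝ) ≤ sigmaE k mu ∧ r = (∑ i, lam i * mu i) / n}

open Finset Polynomial in
/-- elementary symmetric polynomial over a finset -/
noncomputable def ES {ι : Type*} (s : Finset ι) (k : ℕ) (x : ι → ℝ) : ℝ :=
  ∑ t ∈ s.powersetCard k, ∏ i ∈ t, x i

lemma ES_zero {ι : Type*} (s : Finset ι) (x : ι → ℝ) : ES s 0 x = 1 := by
  simp [ES]

lemma ES_insert {ι : Type*} [DecidableEq ι] (s : Finset ι) (i : ι) (hi : i ∉ s) (k : ℕ)
    (x : ι → ℝ) : ES (insert i s) (k+1) x = ES s (k+1) x + x i * ES s k x := by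
  unfold ES
  rw [Finset.powersetCard_succ_insert hi, Finset.sum_union, Finset.sum_image, Finset.mul_sum]
  · congr 1
    refine Finset.sum_congr rfl fun t ht => ?_
    rw [Finset.mem_powersetCard] at ht
    rw [Finset.prod_insert (fun h => hi (ht.1 h))]
  · intro a ha b hb hab
    simp only [Finset.mem_coe, Finset.mem_powersetCard] at ha hb
    have h1 : i ∉ a := fun h => hi (ha.1 h)
    have h2 : i ∉ b := fun h => hi (hb.1 h)
    rw [← Finset.erase_insert h1, ← Finset.erase_insert h2]
    rw [hab]
  · rw [Finset.disjoint_left]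
    intro a ha hb
    simp only [Finset.mem_image, Finset.mem_powersetCard] at ha hb
    obtain ⟨b, hb, rfl⟩ := hb
    exact hi (ha.1 (Finset.mem_insert_self _ _))

lemma ES_erase {ι : Type*} [DecidableEq ι] (s : Finset ι) (i : ι) (hi : i ∈ s) (k : ℕ)
    (x : ι → ℝ) :
    ES s (k+1) x = ES (s.erase i) (k+1) x + x i * ES (s.erase i) k x := by
  have := ES_insert (s.erase i) i (Finset.notMem_erase _ _) k x
  rwa [Finset.insert_erase hi] at this

lemma ES_coeff {ι : Type*} (s : Finset ι) (x : ι → ℝ) (k : ℕ) :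
    (∏ i ∈ s, (1 + Polynomial.C (x i) * Polynomial.X)).coeff k = ES s k x := by
  classical
  induction s using Finset.induction_on generalizing k with
  | empty =>
    cases k with
    | zero => simp [ES]
    | succ k => rw [ES, Finset.powersetCard_eq_empty.2 (by simp)]; simp [Polynomial.coeff_one]
  | insert a s ha ih =>
    rw [Finset.prod_insert ha, add_mul, one_mul, Polynomial.coeff_add, ih]
    cases k with
    | zero => simp [ES_zero, mul_assoc]
    | succ k => rw [ES_insert _ _ ha, mul_assoc, Polynomial.coeff_C_mul,
        Polynomial.coeff_X_mul, ih]

lemma ES_double {ι : Type*} [DecidableEq ι] (s : Finset ι) (k : ℕ) (g : ι → Finset ι → ℝ) :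
    ∑ t ∈ s.powersetCard (k+1), ∑ i ∈ t, g i (t.erase i) =
      ∑ i ∈ s, ∑ u ∈ (s.erase i).powersetCard k, g i u := by
  rw [Finset.sum_sigma', Finset.sum_sigma']
  refine Finset.sum_bij' (fun p _ => ⟨p.2, p.1.erase p.2⟩) (fun p _ => ⟨insert p.1 p.2, p.1⟩)
    ?_ ?_ ?_ ?_ ?_
  · rintro ⟨t, i⟩ h
    simp only [Finset.mem_sigma, Finset.mem_powersetCard] at h ⊢
    refine ⟨h.1.1 h.2, Finset.erase_subset_erase _ h.1.1, ?_⟩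
    rw [Finset.card_erase_of_mem h.2, h.1.2]; rfl
  · rintro ⟨i, u⟩ h
    simp only [Finset.mem_sigma, Finset.mem_powersetCard] at h ⊢
    have hi : i ∉ u := fun hh => by simpa using h.2.1 hh
    refine ⟨⟨?_, ?_⟩, Finset.mem_insert_self _ _⟩
    · exact Finset.insert_subset h.1 (h.2.1.trans (Finset.erase_subset _ _))
    · rw [Finset.card_insert_of_notMem hi, h.2.2]
  · rintro ⟨t, i⟩ h
    simp only [Finset.mem_sigma, Finset.mem_powersetCard] at h ⊢
    rw [Finset.insert_erase h.2]
  · rintro ⟨i, u⟩ h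
    simp only [Finset.mem_sigma, Finset.mem_powersetCard] at h ⊢
    have hi : i ∉ u := fun hh => by simpa using h.2.1 hh
    rw [Finset.erase_insert hi]
  · rintro ⟨t, i⟩ h
    rfl

lemma ES_euler {ι : Type*} [DecidableEq ι] (s : Finset ι) (k : ℕ) (x : ι → ℝ) :
    ((k:ℝ)+1) * ES s (k+1) x = ∑ i ∈ s, x i * ES (s.erase i) k x := by
  have := ES_double s k (fun i u => x i * ∏ j ∈ u, x j)
  simp only [ES, Finset.mul_sum]
  rw [← this]
  refine Finset.sum_congr rfl fun t ht => ?_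
  rw [Finset.mem_powersetCard] at ht
  rw [Finset.sum_congr rfl (fun i hi => Finset.mul_prod_erase t x hi)]
  simp [ht.2]

lemma ES_smul {ι : Type*} (s : Finset ι) (k : ℕ) (c : ℝ) (x : ι → ℝ) :
    ES s k (c • x) = c ^ k * ES s k x := by
  simp only [ES, Finset.mul_sum]
  refine Finset.sum_congr rfl fun t ht => ?_
  rw [Finset.mem_powersetCard] at ht
  simp [Finset.prod_mul_distrib, ht.2]

lemma splits_deriv (p : Polynomial ℝ) (hp : p.Splits) : (Polynomial.derivative p).Splits := by
  rw [Polynomial.splits_iff_card_roots] at hp ⊢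
  have h1 := p.card_roots_le_derivative
  have h2 := (Polynomial.derivative p).card_roots'
  have h3 := Polynomial.natDegree_derivative_le p
  by_cases h0 : p.natDegree = 0
  · have : Polynomial.derivative p = 0 := Polynomial.derivative_of_natDegree_zero h0
    simp [this]
  · omega

lemma splits_iter (p : Polynomial ℝ) (hp : p.Splits) (k : ℕ) :
    (Polynomial.derivative^[k] p).Splits := by
  induction k with
  | zero => exact hp
  | succ k ih => rw [Function.iterate_succ_apply']; exact splits_deriv _ ih

lemma splits_quad (p : Polynomial ℝ) (hp : p.Splits) :
    2 * p.coeff 0 * p.coeff 2 ≤ p.coeff 1 ^ 2 := by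
  rw [hp.eq_prod_roots]
  generalize p.leadingCoeff = a
  generalize p.roots = m
  have key : ∀ q : Polynomial ℝ, q = (m.map fun a => Polynomial.X - Polynomial.C a).prod →
      2 * q.coeff 0 * q.coeff 2 ≤ q.coeff 1 ^ 2 := by
    induction m using Multiset.induction_on with
    | empty => intro q hq; subst hq; simp [Polynomial.coeff_one]
    | cons r m ih =>
      intro q hq
      have := ih _ rfl
      simp only [Multiset.map_cons, Multiset.prod_cons] at hq
      generalize (m.map fun a => Polynomial.X - Polynomial.C a).prod = w at *
      subst hq
      simp only [sub_mul, Polynomial.coeff_sub, Polynomial.coeff_C_mul,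
        Polynomial.coeff_X_mul, Polynomial.coeff_X_mul_zero,
        show (2:ℕ) = 1 + 1 from rfl, show w.coeff 1 = w.coeff (0+1) from rfl] at this ⊢
      norm_num at this ⊢
      nlinarith [mul_nonneg (sq_nonneg r) (sub_nonneg.2 this), sq_nonneg (w.coeff 0)]
  have := key _ rfl
  simp only [Polynomial.coeff_C_mul]
  nlinarith [mul_nonneg (sq_nonneg a) (sub_nonneg.2 this)]

lemma ES_newton {ι : Type*} (s : Finset ι) (k : ℕ) (x : ι → ℝ) :
    ES s k x * ES s (k+2) x ≤ ES s (k+1) x ^ 2 := by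
  rcases le_or_gt (ES s k x * ES s (k+2) x) 0 with h | h
  · exact h.trans (sq_nonneg _)
  have hs : (∏ i ∈ s, (1 + Polynomial.C (x i) * Polynomial.X)).Splits := by
    refine Polynomial.Splits.prod fun i _ => Polynomial.Splits.of_natDegree_le_one ?_
    compute_degree
  have := splits_quad _ (splits_iter _ hs k)
  simp only [Polynomial.coeff_iterate_derivative, ES_coeff, nsmul_eq_mul, zero_add] at this
  rw [add_comm 2 k, add_comm 1 k] at this
  have h0 : (k.descFactorial k : ℝ) = k.factorial := by rw [Nat.descFactorial_self]
  have h1 : ((k+1).descFactorial k : ℝ) = (k+1) * k.factorial := by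
    have := Nat.succ_descFactorial k k
    rw [Nat.descFactorial_self] at this
    have h : (k+1-k) = 1 := by omega
    rw [h, one_mul] at this
    rw [this]; push_cast; ring
  have h2 : 2 * ((k+2).descFactorial k : ℝ) = (k+2) * (k+1) * k.factorial := by
    have := Nat.succ_descFactorial (k+1) k
    have h : (k+1+1-k) = 2 := by omega
    rw [h] at this
    have h3 : (2 * (k+2).descFactorial k : ℝ) = ((2 * (k+1+1).descFactorial k : ℕ) : ℝ) := by
      push_cast; ring
    rw [h3, this]; push_cast; rw [h1]; ring
  rw [h0, h1] at this
  have hf : (0:ℝ) < k.factorial := by positivity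
  have h4 : ((k:ℝ)+2) * (k+1) * (k.factorial)^2 * (ES s k x * ES s (k+2) x)
      ≤ ((k+1) * k.factorial)^2 * ES s (k+1) x ^ 2 := by
    calc _ = k.factorial * (2 * ((k+2).descFactorial k : ℝ)) * (ES s k x * ES s (k+2) x) := by
          rw [h2]; ring
      _ ≤ _ := by linarith
  have h5 : ((k+1) * (k.factorial:ℝ))^2 * (ES s k x * ES s (k+2) x)
      ≤ ((k:ℝ)+2) * (k+1) * (k.factorial)^2 * (ES s k x * ES s (k+2) x) := by
    apply mul_le_mul_of_nonneg_right _ h.le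
    have : (0:ℝ) ≤ (k+1) * (k.factorial:ℝ)^2 := by positivity
    nlinarith
  have h6 : (0:ℝ) < ((k+1) * (k.factorial:ℝ))^2 := by positivity
  exact le_of_mul_le_mul_left (h5.trans h4) h6

def Cone {ι : Type*} (s : Finset ι) (k : ℕ) (x : ι → ℝ) : Prop := ∀ j ≤ k, 0 < ES s j x

lemma cone_erase {ι : Type*} [DecidableEq ι] (s : Finset ι) (k : ℕ) (x : ι → ℝ) (i : ι)
    (hi : i ∈ s) (h : Cone s (k+1) x) : Cone (s.erase i) k x := by
  intro j
  induction j with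
  | zero => intro _; rw [ES_zero]; norm_num
  | succ j ih =>
    intro hj
    have h1 := ih (by omega)
    by_contra hc
    push Not at hc
    have a1 := h (j+1) (by omega)
    have a2 := h (j+2) (by omega)
    rw [ES_erase s i hi] at a1 a2
    have hN := ES_newton (s.erase i) j x
    set p := ES (s.erase i) j x
    set q := ES (s.erase i) (j+1) x
    set r := ES (s.erase i) (j+1+1) x
    have : p * r ≤ q ^ 2 := hN
    have b1 : p * (-(x i * q)) < p * r := mul_lt_mul_of_pos_left (by linarith) h1
    nlinarith [mul_nonneg (neg_nonneg.2 hc) (a1.le)]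

lemma ML_ident {ι : Type*} [DecidableEq ι] (s : Finset ι) (k : ℕ) (x : ι → ℝ)
    (h : 0 < ES s (k+1) x) :
    ((k:ℝ)+2) * (ES s (k+2) x / ES s (k+1) x) =
      ∑ i ∈ s, (x i - x i ^ 2 * (ES (s.erase i) k x / ES s (k+1) x)) := by
  have := ES_euler s (k+1) x
  rw [← mul_div_assoc, div_eq_iff h.ne', Finset.sum_mul]
  push_cast at this
  rw [show ((k:ℝ)+2) = k+1+1 by ring, this]
  refine Finset.sum_congr rfl fun i hi => ?_
  have e := ES_erase s i hi k x
  field_simp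
  rw [e]; ring

lemma ML_alg (x y a b c : ℝ) (ha : 0 < a) (hb : 0 < b) (hc : a + b ≤ c) :
    (x+y)^2 / c ≤ x^2/a + y^2/b := by
  have : (x+y)^2/c ≤ (x+y)^2/(a+b) :=
    div_le_div_of_nonneg_left (sq_nonneg _) (by positivity) hc
  refine this.trans ?_
  rw [div_add_div _ _ ha.ne' hb.ne', div_le_div_iff₀ (by positivity) (by positivity)]
  nlinarith [sq_nonneg (x*b - y*a), mul_pos ha hb]

lemma ML {ι : Type*} [DecidableEq ι] (k : ℕ) : ∀ (s : Finset ι) (x y : ι → ℝ),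
    Cone s (k+1) x → Cone s (k+1) y →
    Cone s (k+1) (x+y) ∧
    ES s (k+1) x / ES s k x + ES s (k+1) y / ES s k y ≤ ES s (k+1) (x+y) / ES s k (x+y) := by
  induction k with
  | zero =>
    intro s x y hx hy
    have e : ES s 1 (x+y) = ES s 1 x + ES s 1 y := by
      have h1 := ES_euler s 0 (x+y)
      have h2 := ES_euler s 0 x
      have h3 := ES_euler s 0 y
      simp only [ES_zero, Nat.cast_zero, zero_add, one_mul, mul_one] at h1 h2 h3
      rw [h1, h2, h3, ← Finset.sum_add_distrib]; rfl
    refine ⟨?_, ?_⟩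
    · intro j hj
      interval_cases j
      · rw [ES_zero]; norm_num
      · rw [e]; exact add_pos (hx 1 le_rfl) (hy 1 le_rfl)
    · simp [ES_zero, e]
  | succ k ih =>
    intro s x y hx hy
    have c0 : Cone s (k+1) (x+y) :=
      (ih s x y (fun j hj => hx j (by omega)) (fun j hj => hy j (by omega))).1
    have px := hx (k+1) (by omega)
    have py := hy (k+1) (by omega)
    have pz := c0 (k+1) le_rfl
    have ineq : ES s (k+2) x / ES s (k+1) x + ES s (k+2) y / ES s (k+1) y
        ≤ ES s (k+2) (x+y) / ES s (k+1) (x+y) := by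
      have hk : (0:ℝ) < (k:ℝ)+2 := by positivity
      refine le_of_mul_le_mul_left ?_ hk
      rw [mul_add, ML_ident s k x px, ML_ident s k y py, ML_ident s k (x+y) pz,
        ← Finset.sum_add_distrib]
      refine Finset.sum_le_sum fun i hi => ?_
      have cx := cone_erase s (k+1) x i hi hx
      have cy := cone_erase s (k+1) y i hi hy
      obtain ⟨cz, hh⟩ := ih (s.erase i) x y cx cy
      have qx := cx k (by omega)
      have qy := cy k (by omega)
      have qz := cz k (by omega)
      have hx' : ES s (k+1) x / ES (s.erase i) k x
          = x i + ES (s.erase i) (k+1) x / ES (s.erase i) k x := by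
        rw [ES_erase s i hi]; field_simp; ring
      have hy' : ES s (k+1) y / ES (s.erase i) k y
          = y i + ES (s.erase i) (k+1) y / ES (s.erase i) k y := by
        rw [ES_erase s i hi]; field_simp; ring
      have hz' : ES s (k+1) (x+y) / ES (s.erase i) k (x+y)
          = (x+y) i + ES (s.erase i) (k+1) (x+y) / ES (s.erase i) k (x+y) := by
        rw [ES_erase s i hi]; field_simp; ring
      have := ML_alg (x i) (y i) (ES s (k+1) x / ES (s.erase i) k x)
        (ES s (k+1) y / ES (s.erase i) k y) (ES s (k+1) (x+y) / ES (s.erase i) k (x+y))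
        (by positivity) (by positivity) (by
          rw [hx', hy', hz']; simp only [Pi.add_apply]; linarith)
      rw [div_div_eq_mul_div, div_div_eq_mul_div, div_div_eq_mul_div,
        mul_div_assoc, mul_div_assoc, mul_div_assoc] at this
      simp only [Pi.add_apply]
      linarith
    refine ⟨?_, ineq⟩
    intro j hj
    rcases Nat.lt_or_ge j (k+2) with h | h
    · exact c0 j (by omega)
    · obtain rfl : j = k+2 := by omega
      have p1 : 0 < ES s (k+2) x / ES s (k+1) x := div_pos (hx _ le_rfl) px
      have p2 : 0 < ES s (k+2) y / ES s (k+1) y := div_pos (hy _ le_rfl) py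
      exact (div_pos_iff_of_pos_right pz).1 (by linarith)

lemma cone_smul {ι : Type*} (s : Finset ι) (k : ℕ) (c : ℝ) (hc : 0 < c) (x : ι → ℝ)
    (h : Cone s k x) : Cone s k (c • x) := fun j hj => by
  rw [ES_smul]; exact mul_pos (pow_pos hc _) (h j hj)

lemma one_add_sum_le (k : ℕ) (r : ℕ → ℝ) (hr : ∀ i ∈ Finset.range k, 0 ≤ r i) :
    1 + ∑ i ∈ Finset.range k, r i ≤ ∏ i ∈ Finset.range k, (1 + r i) := by
  induction k with
  | zero => simp
  | succ k ih =>
    rw [Finset.sum_range_succ, Finset.prod_range_succ]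
    have h1 := ih (fun i hi => hr i (by simp at hi ⊢; omega))
    have h2 := hr k (by simp)
    have h3 : 0 ≤ ∑ i ∈ Finset.range k, r i :=
      Finset.sum_nonneg (fun i hi => hr i (by simp at hi ⊢; omega))
    nlinarith

lemma ES_telescope {ι : Type*} (s : Finset ι) (k : ℕ) (x : ι → ℝ) (h : Cone s k x) :
    ES s k x = ∏ j ∈ Finset.range k, (ES s (j+1) x / ES s j x) := by
  induction k with
  | zero => simp [ES_zero]
  | succ k ih =>
    rw [Finset.prod_range_succ, ← ih (fun j hj => h j (by omega))]
    have := h k (by omega)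
    field_simp

lemma garding_t {ι : Type*} [DecidableEq ι] (s : Finset ι) (k : ℕ) (hk : 1 ≤ k) (x y : ι → ℝ)
    (hx : Cone s k x) (hy : Cone s k y) (t : ℝ) (ht : 0 < t) :
    ES s k x + t * (k * (ES s k x * (ES s k y / ES s k x) ^ ((1:ℝ)/k))) ≤ ES s k (x + t • y) := by
  set r : ℕ → ℝ := fun j => (ES s (j+1) y / ES s j y) / (ES s (j+1) x / ES s j x) with hr
  have hrp : ∀ j ∈ Finset.range k, 0 < r j := by
    intro j hj
    simp only [Finset.mem_range] at hj
    have := hx j (by omega); have := hx (j+1) (by omega)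
    have := hy j (by omega); have := hy (j+1) (by omega)
    simp only [hr]; positivity
  have hprod : ∏ j ∈ Finset.range k, r j = ES s k y / ES s k x := by
    simp only [hr]
    rw [Finset.prod_div_distrib, ← ES_telescope s k y hy, ← ES_telescope s k x hx]
  have hk0 : (0:ℝ) < k := by exact_mod_cast hk
  have amgm : k * (ES s k y / ES s k x) ^ ((1:ℝ)/k) ≤ ∑ j ∈ Finset.range k, r j := by
    have := Real.geom_mean_le_arith_mean (Finset.range k) (fun _ => 1) r (by simp)
      (by simp; omega) (fun i hi => (hrp i hi).le)
    simp only [Real.rpow_one, Finset.sum_const, Finset.card_range, nsmul_eq_mul, mul_one,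
      one_mul, hprod] at this
    rw [le_div_iff₀ hk0] at this
    rw [one_div]; linarith
  have hX := hx k le_rfl
  have hz : Cone s k (x + t • y) := by
    obtain ⟨m, rfl⟩ : ∃ m, k = m+1 := ⟨k-1, by omega⟩
    exact (ML m s x (t • y) hx (cone_smul _ _ _ ht _ hy)).1
  have hge : ES s k x * ∏ j ∈ Finset.range k, (1 + t * r j) ≤ ES s k (x + t • y) := by
    rw [ES_telescope s k x hx, ES_telescope s k _ hz, ← Finset.prod_mul_distrib]
    refine Finset.prod_le_prod ?_ ?_
    · intro j hj
      have := hrp j hj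
      simp only [Finset.mem_range] at hj
      have := hx j (by omega); have := hx (j+1) (by omega)
      positivity
    · intro j hj
      simp only [Finset.mem_range] at hj
      have a := hx j (by omega)
      have b := hx (j+1) (by omega)
      have c := hy j (by omega)
      refine le_trans (le_of_eq ?_) (ML j s x (t • y) (fun i hi => hx i (by omega))
        (cone_smul _ _ _ ht _ (fun i hi => hy i (by omega)))).2
      simp only [hr, ES_smul]
      field_simp
      ring
  have h1 := one_add_sum_le k (fun j => t * r j) (fun i hi => (mul_pos ht (hrp i hi)).le)
  rw [← Finset.mul_sum] at h1
  have h2 : t * (k * (ES s k y / ES s k x) ^ ((1:ℝ)/k)) ≤ t * ∑ j ∈ Finset.range k, r j :=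
    mul_le_mul_of_nonneg_left amgm ht.le
  have h3 : ES s k x * (1 + t * (k * (ES s k y / ES s k x) ^ ((1:ℝ)/k)))
      ≤ ES s k x * ∏ j ∈ Finset.range k, (1 + t * r j) :=
    mul_le_mul_of_nonneg_left (by linarith) hX.le
  calc _ = ES s k x * (1 + t * (k * (ES s k y / ES s k x) ^ ((1:ℝ)/k))) := by ring
    _ ≤ _ := h3.trans hge

lemma det_deriv {m : Type*} [Fintype m] [DecidableEq m] (d : m → ℝ) (B : Matrix m m ℝ) :
    HasDerivAt (fun t : ℝ => (Matrix.diagonal d + t • B).det)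
      (∑ i, B i i * ∏ j ∈ Finset.univ.erase i, d j) 0 := by
  have entry : ∀ i j : m, HasDerivAt (fun t : ℝ => (Matrix.diagonal d + t • B) i j) (B i j) 0 := by
    intro i j
    simp only [Matrix.add_apply, Matrix.smul_apply, smul_eq_mul]
    simpa using ((hasDerivAt_id (0:ℝ)).mul_const (B i j)).const_add (Matrix.diagonal d i j)
  have hs : ∀ σ : Equiv.Perm m, HasDerivAt
      (fun t : ℝ => Equiv.Perm.sign σ • ∏ i, (Matrix.diagonal d + t • B) (σ i) i)
      (if σ = 1 then ∑ i, B i i * ∏ j ∈ Finset.univ.erase i, d j else 0) 0 := by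
    intro σ
    have h := (HasDerivAt.fun_finsetProd (u := Finset.univ)
      (fun i _ => entry (σ i) i)).const_mul ((Equiv.Perm.sign σ : ℤ) : ℝ)
    have e : (fun t : ℝ => Equiv.Perm.sign σ • ∏ i, (Matrix.diagonal d + t • B) (σ i) i)
        = fun t : ℝ => ((Equiv.Perm.sign σ : ℤ) : ℝ) *
          ∏ i, (Matrix.diagonal d + t • B) (σ i) i := by
      funext t
      rw [Units.smul_def, zsmul_eq_mul]
    rw [e]
    refine h.congr_deriv ?_
    symm
    split_ifs with h1
    · subst h1
      simp [mul_comm]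
    · symm
      apply mul_eq_zero_of_right
      refine Finset.sum_eq_zero fun i _ => ?_
      obtain ⟨a, ha⟩ : ∃ a, σ a ≠ a := by
        by_contra hc
        push Not at hc
        exact h1 (Equiv.ext hc)
      obtain ⟨b, hbi, hb⟩ : ∃ b, b ≠ i ∧ σ b ≠ b := by
        by_cases hai : a = i
        · refine ⟨σ a, ?_, ?_⟩
          · rw [← hai]; exact ha
          · exact fun hh => ha (σ.injective hh)
        · exact ⟨a, hai, ha⟩
      rw [Finset.prod_eq_zero (i := b) (by simp [hbi]), zero_smul]
      simp [Matrix.diagonal_apply_ne _ hb]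
  have := HasDerivAt.fun_sum (u := Finset.univ) (fun σ _ => hs σ)
  simp only [Finset.sum_ite_eq', Finset.mem_univ, if_true] at this
  simpa only [Matrix.det_apply] using this

/-- coefficient of `det (1 + X A)` -/
noncomputable def QM {n : ℕ} (k : ℕ) (A : Matrix (Fin n) (Fin n) ℝ) : ℝ :=
  (Matrix.det (1 + (Polynomial.X : Polynomial ℝ) • A.map Polynomial.C)).coeff k

lemma QM_conj {n : ℕ} (k : ℕ) (U V D : Matrix (Fin n) (Fin n) ℝ) (h : V * U = 1) :
    QM k (U * D * V) = QM k D := by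
  unfold QM
  have e1 : (Polynomial.X : Polynomial ℝ) • (U * D * V).map Polynomial.C
      = ((Polynomial.X : Polynomial ℝ) • (U * D).map Polynomial.C) * V.map Polynomial.C := by
    rw [Matrix.map_mul, Matrix.smul_mul]
  have e2 : V.map Polynomial.C * ((Polynomial.X : Polynomial ℝ) • (U * D).map Polynomial.C)
      = (Polynomial.X : Polynomial ℝ) • D.map Polynomial.C := by
    rw [Matrix.mul_smul, ← Matrix.map_mul, ← Matrix.mul_assoc, h, Matrix.one_mul]
  rw [e1, Matrix.det_one_add_mul_comm, e2]

lemma QM_diag {n : ℕ} (k : ℕ) (d : Fin n → ℝ) :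
    QM k (Matrix.diagonal d) = ES Finset.univ k d := by
  unfold QM
  rw [← ES_coeff]
  have : (1 + (Polynomial.X : Polynomial ℝ) • (Matrix.diagonal d).map Polynomial.C)
      = Matrix.diagonal (fun i => 1 + Polynomial.C (d i) * Polynomial.X) := by
    ext1 i j
    by_cases h : i = j
    · subst h
      simp only [Matrix.add_apply, Matrix.one_apply_eq, Matrix.smul_apply, Matrix.map_apply,
        Matrix.diagonal_apply_eq, smul_eq_mul]
      rw [mul_comm]
    · simp only [Matrix.add_apply, Matrix.one_apply_ne h, Matrix.smul_apply, Matrix.map_apply,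
        Matrix.diagonal_apply_ne _ h, smul_eq_mul, map_zero, mul_zero, add_zero]
  rw [this, Matrix.det_diagonal]

lemma QM_deriv {n : ℕ} (k : ℕ) (d : Fin n → ℝ) (B : Matrix (Fin n) (Fin n) ℝ) :
    HasDerivAt (fun t : ℝ => QM (k+1) (Matrix.diagonal d + t • B))
      (∑ i, B i i * ES (Finset.univ.erase i) k d) 0 := by
  simp only [QM, Matrix.coeff_det_one_add_X_smul_eq_sum_minors]
  have e : ∑ i, B i i * ES (Finset.univ.erase i) k d =
      ∑ s ∈ Finset.powersetCard (k+1) (Finset.univ : Finset (Fin n)),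
        ∑ i ∈ s, B i i * ∏ j ∈ s.erase i, d j := by
    rw [ES_double _ _ (fun i u => B i i * ∏ j ∈ u, d j)]
    simp [ES, Finset.mul_sum]
  rw [e]
  refine HasDerivAt.fun_sum fun s _ => ?_
  have := det_deriv (m := s) (fun i => d i)
    (B.submatrix (Subtype.val : s → Fin n) (Subtype.val : s → Fin n))
  have e2 : (fun t : ℝ => ((Matrix.diagonal d + t • B).submatrix (Subtype.val : s → Fin n)
      (Subtype.val : s → Fin n)).det) = fun t => ((Matrix.diagonal fun i : s => d i) +
      t • B.submatrix (Subtype.val : s → Fin n) (Subtype.val : s → Fin n)).det := by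
    funext t
    congr 1
    ext i j
    by_cases h : i = j
    · subst h; simp
    · have : (i : Fin n) ≠ j := fun hh => h (Subtype.ext hh)
      simp [h, this]
  rw [e2]
  refine this.congr_deriv ?_
  · rw [← Finset.sum_coe_sort s]
    refine Finset.sum_congr rfl fun i _ => ?_
    simp only [Matrix.submatrix_apply]
    congr 1
    refine Finset.prod_bij (fun a _ => (a : Fin n)) ?_ ?_ ?_ ?_
    · intro a ha
      simp only [Finset.mem_erase, Finset.mem_univ, and_true] at ha ⊢
      exact ⟨fun h => ha (Subtype.ext h), a.2⟩
    · intro a _ b _ h; exact Subtype.ext h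
    · intro b hb
      simp only [Finset.mem_erase] at hb
      exact ⟨⟨b, hb.2⟩, by simp [Subtype.ext_iff, hb.1], rfl⟩
    · intro a _; rfl

lemma deriv_ge (g : ℝ → ℝ) (g' c : ℝ) (h : HasDerivAt g g' 0)
    (hc : ∀ t > 0, g 0 + t * c ≤ g t) : c ≤ g' := by
  have h1 := h.tendsto_slope_zero_right
  refine ge_of_tendsto h1 ?_
  filter_upwards [self_mem_nhdsWithin] with t ht
  have ht' : 0 < t := ht
  have := hc t ht'
  rw [zero_add, smul_eq_mul, inv_mul_eq_div, le_div_iff₀ ht']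
  linarith

lemma garding {n : ℕ} (k : ℕ) (x y : Fin n → ℝ)
    (hx : Cone Finset.univ (k+1) x) (hy : Cone Finset.univ (k+1) y) :
    ((k+1 : ℕ):ℝ) * (ES Finset.univ (k+1) x *
      (ES Finset.univ (k+1) y / ES Finset.univ (k+1) x) ^ ((1:ℝ)/((k+1 : ℕ) : ℝ)))
      ≤ ∑ i, y i * ES (Finset.univ.erase i) k x := by
  have h := QM_deriv k x (Matrix.diagonal y)
  simp only [Matrix.diagonal_apply_eq] at h
  refine deriv_ge _ _ _ h ?_
  intro t ht
  have := garding_t Finset.univ (k+1) (by omega) x y hx hy t ht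
  have e : Matrix.diagonal x + t • Matrix.diagonal y = Matrix.diagonal (x + t • y) := by
    rw [← Matrix.diagonal_smul, Matrix.diagonal_add]; rfl
  rw [e, QM_diag, zero_smul, add_zero, QM_diag]
  exact this

lemma ES_perm {n : ℕ} (k : ℕ) (x : Fin n → ℝ) (σ : Equiv.Perm (Fin n)) :
    ES Finset.univ k (x ∘ σ) = ES Finset.univ k x := by
  rw [← ES_coeff, ← ES_coeff]
  congr 1
  exact Equiv.prod_comp σ (fun i => 1 + Polynomial.C (x i) * Polynomial.X)

lemma cone_iff {n k : ℕ} (x : Fin n → ℝ) : x ∈ GardingCone n k ↔ Cone Finset.univ k x := by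
  constructor
  · intro h j hj
    cases j with
    | zero => rw [ES_zero]; norm_num
    | succ j => exact h (j+1) (by omega) hj
  · intro h j _ hj
    exact h j hj

lemma SkM_eq {n : ℕ} (k : ℕ) (A : Matrix (Fin n) (Fin n) ℝ) (hA : A.IsHermitian) :
    SkM k A = QM k A := by
  rw [SkM, dif_pos hA]
  conv_rhs => rw [hA.spectral_theorem, Unitary.conjStarAlgAut_apply]
  rw [QM_conj _ _ _ _ (by simp), QM_diag]
  rfl

lemma rho_val (k : ℕ) (n C S : ℝ) (hk : 1 ≤ k) (hC : 0 < C) (hS : 0 < S) :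
    (k * (S * (C / S) ^ ((1:ℝ)/k))) / n = (k / n) * C ^ ((1:ℝ)/k) * S ^ (((k:ℝ)-1)/k) := by
  have hk0 : (0:ℝ) < k := by exact_mod_cast hk
  rw [Real.div_rpow hC.le hS.le]
  have : S ^ (((k:ℝ)-1)/k) = S / S ^ ((1:ℝ)/k) := by
    rw [sub_div, div_self hk0.ne', Real.rpow_sub hS, Real.rpow_one]
  rw [this]; ring

lemma unique_grad {n : ℕ} (M N : Matrix (Fin n) (Fin n) ℝ) (hM : M.IsHermitian)
    (hN : N.IsHermitian)
    (h : ∀ B : Matrix (Fin n) (Fin n) ℝ, B.IsHermitian → (M * B).trace = (N * B).trace) :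
    M = N := by
  have h1 := h (M - N) (hM.sub hN)
  have h2 : ((M - N).conjTranspose * (M - N)).trace = 0 := by
    rw [(hM.sub hN).eq, Matrix.sub_mul, Matrix.trace_sub, h1, sub_self]
  exact sub_eq_zero.1 (Matrix.trace_conjTranspose_mul_self_eq_zero_iff.1 h2)

lemma perm_eig {n : ℕ} (U V M : Matrix (Fin n) (Fin n) ℝ) (f : Fin n → ℝ) (h : V * U = 1)
    (hM : M.IsHermitian) (e : M = U * Matrix.diagonal f * V) :
    ∃ σ : Equiv.Perm (Fin n), hM.eigenvalues = f ∘ σ := by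
  have h1 := hM.roots_charpoly_eq_eigenvalues
  have h2 : M.charpoly = (Matrix.diagonal f).charpoly := by
    rw [e, Matrix.charpoly_mul_comm, ← Matrix.mul_assoc, h, Matrix.one_mul]
  rw [h2, Matrix.charpoly_diagonal, Polynomial.roots_prod] at h1
  · simp only [Polynomial.roots_X_sub_C, Multiset.bind_singleton] at h1
    have hc : ∀ c : ℝ, Nonempty ({a // hM.eigenvalues a = c} ≃ {b // f b = c}) := by
      intro c
      have h3 := congrArg (Multiset.count c) h1
      rw [Multiset.count_map, Multiset.count_map] at h3
      refine ⟨Fintype.equivOfCardEq ?_⟩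
      rw [Fintype.card_subtype, Fintype.card_subtype]
      rw [Finset.card_def, Finset.card_def, Finset.filter_val, Finset.filter_val]
      simp only [Function.comp_apply, RCLike.ofReal_real_eq_id, id_eq] at h3
      simp only [eq_comm (b := c)]
      exact h3.symm
    let σ := Equiv.ofFiberEquiv (fun c => (hc c).some)
    refine ⟨σ, ?_⟩
    funext i
    exact (Equiv.ofFiberEquiv_map (fun c => (hc c).some) i).symm
  · simp [Finset.prod_ne_zero_iff, Polynomial.X_sub_C_ne_zero]

/-- **The gradient matrix `S_k'(A)` of the k-Hessian operator** (Statement 5). For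
`λ(A) ∈ Γ_k`, there is a unique symmetric matrix `M = S_k'(A)` with
`(d/dt)|_{t=0} S_k(A + tB) = trace(M·B)` for all symmetric `B`; any such `M` is positive
definite, has `λ(M) ∈ Γ_k^*`, and `ρ_k^*(λ(M)) = (k/n)·C(n,k)^{1/k}·S_k(A)^{(k−1)/k}`. -/
theorem Sk_gradient_matrix (n k : ℕ) (hn : 2 ≤ n) (hk1 : 1 ≤ k) (hkn : k ≤ n)
    (A : Matrix (Fin n) (Fin n) ℝ) (hA : A.IsHermitian)
    (hAG : hA.eigenvalues ∈ GardingCone n k) :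
    (∃! M : Matrix (Fin n) (Fin n) ℝ, M.IsHermitian ∧
      ∀ B : Matrix (Fin n) (Fin n) ℝ, B.IsHermitian →
        deriv (fun t : ℝ => SkM k (A + t • B)) 0 = (M * B).trace) ∧
    ∀ (M : Matrix (Fin n) (Fin n) ℝ) (hM : M.IsHermitian),
      (∀ B : Matrix (Fin n) (Fin n) ℝ, B.IsHermitian →
        deriv (fun t : ℝ => SkM k (A + t • B)) 0 = (M * B).trace) →
      M.PosDef ∧ hM.eigenvalues ∈ GardingDual n k ∧
        rhoStar n k hM.eigenvalues
          = ((k : ℝ) / n) * (n.choose k : ℝ) ^ ((1 : ℝ) / k)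
              * SkM k A ^ (((k : ℝ) - 1) / k) := by
  obtain ⟨m, rfl⟩ : ∃ m, k = m + 1 := ⟨k - 1, by omega⟩
  set U : Matrix (Fin n) (Fin n) ℝ := (hA.eigenvectorUnitary : Matrix (Fin n) (Fin n) ℝ) with hU
  set V : Matrix (Fin n) (Fin n) ℝ := star U with hV
  have hVU : V * U = 1 := by simp [hV, hU]
  have hUV : U * V = 1 := mul_eq_one_comm.1 hVU
  set lam := hA.eigenvalues with hlam
  have hAe : A = U * Matrix.diagonal lam * V := by
    conv_lhs => rw [hA.spectral_theorem, Unitary.conjStarAlgAut_apply]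
    rfl
  have hcone : Cone Finset.univ (m+1) lam := (cone_iff lam).1 hAG
  set f : Fin n → ℝ := fun i => ES (Finset.univ.erase i) m lam with hf
  have hfpos : ∀ i, 0 < f i := fun i =>
    cone_erase Finset.univ m lam i (Finset.mem_univ i) hcone m le_rfl
  set M0 : Matrix (Fin n) (Fin n) ℝ := U * Matrix.diagonal f * V with hM0
  have hM0H : M0.IsHermitian := by
    have h1 : (Matrix.diagonal f).IsHermitian := Matrix.isHermitian_diagonal f
    have := Matrix.isHermitian_mul_mul_conjTranspose U h1
    exact this
  have hgrad : ∀ B : Matrix (Fin n) (Fin n) ℝ, B.IsHermitian →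
      deriv (fun t : ℝ => SkM (m+1) (A + t • B)) 0 = (M0 * B).trace := by
    intro B hB
    have e : (fun t : ℝ => SkM (m+1) (A + t • B)) =
        fun t : ℝ => QM (m+1) (Matrix.diagonal lam + t • (V * B * U)) := by
      funext t
      have hH : (A + t • B).IsHermitian := by
        refine hA.add ?_
        rw [Matrix.IsHermitian, Matrix.conjTranspose_smul, hB.eq]; rfl
      rw [SkM_eq _ _ hH, ← QM_conj (m+1) U V (Matrix.diagonal lam + t • (V * B * U)) hVU]
      congr 1
      rw [Matrix.mul_add, Matrix.add_mul, ← hAe, Matrix.mul_smul, Matrix.smul_mul]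
      congr 2
      calc B = (U * V) * B * (U * V) := by rw [hUV, Matrix.one_mul, Matrix.mul_one]
        _ = _ := by simp only [Matrix.mul_assoc]
    rw [e, (QM_deriv m lam (V * B * U)).deriv]
    have e2 : (M0 * B).trace = (Matrix.diagonal f * (V * B * U)).trace := by
      rw [hM0, Matrix.mul_assoc, Matrix.mul_assoc, Matrix.trace_mul_comm]
      simp only [Matrix.mul_assoc]
    rw [e2, Matrix.trace]
    refine Finset.sum_congr rfl fun i _ => ?_
    rw [Matrix.diag_apply, Matrix.diagonal_mul, mul_comm]
  refine ⟨⟨M0, ⟨hM0H, hgrad⟩, ?_⟩, ?_⟩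
  · rintro N ⟨hN, hN2⟩
    exact unique_grad N M0 hN hM0H fun B hB => by rw [← hN2 B hB, hgrad B hB]
  intro M hM hMg
  have hMe : M = M0 := unique_grad M M0 hM hM0H fun B hB => by rw [← hMg B hB, hgrad B hB]
  obtain ⟨σ, hσ⟩ := perm_eig U V M f hVU hM hMe
  have hsum : ∀ mu : Fin n → ℝ,
      ∑ i, hM.eigenvalues i * mu i = ∑ i, (mu ∘ σ.symm) i * f i := by
    intro mu
    rw [hσ, ← Equiv.sum_comp σ (fun i => (mu ∘ σ.symm) i * f i)]
    refine Finset.sum_congr rfl fun i _ => ?_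
    simp [mul_comm]
  have hperm : ∀ mu ∈ GardingCone n (m+1), Cone Finset.univ (m+1) (mu ∘ σ.symm) := by
    intro mu hmu j hj
    rw [ES_perm]
    exact (cone_iff mu).1 hmu j hj
  have hS : 0 < ES Finset.univ (m+1) lam := hcone _ le_rfl
  have hk0 : (0:ℝ) < ((m+1 : ℕ) : ℝ) := by positivity
  have hn0 : (0:ℝ) < n := by exact_mod_cast (by omega : 0 < n)
  have hC : (0:ℝ) < (n.choose (m+1) : ℝ) := by exact_mod_cast Nat.choose_pos hkn
  refine ⟨?_, ?_, ?_⟩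
  · rw [hM.posDef_iff_eigenvalues_pos]
    intro i
    rw [hσ]; exact hfpos _
  · intro mu hmu
    rw [hsum]
    have h1 := hperm mu hmu
    refine le_trans ?_ (garding m lam (mu ∘ σ.symm) hcone h1)
    have := h1 (m+1) le_rfl
    positivity
  · have hSk : SkM (m+1) A = ES Finset.univ (m+1) lam := by
      rw [SkM, dif_pos hA]; rfl
    rw [hSk, ← rho_val (m+1) n _ _ hk1 hC hS]
    refine IsLeast.csInf_eq ⟨?_, ?_⟩
    · set c : ℝ := ((n.choose (m+1) : ℝ) / ES Finset.univ (m+1) lam) ^ ((1:ℝ)/((m+1 : ℕ):ℝ)) with hc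
      have hcp : 0 < c := Real.rpow_pos_of_pos (div_pos hC hS) _
      have hck : c ^ (m+1) = (n.choose (m+1) : ℝ) / ES Finset.univ (m+1) lam := by
        rw [hc, one_div]
        exact Real.rpow_inv_natCast_pow (div_pos hC hS).le (by omega)
      refine ⟨(c • lam) ∘ σ, ?_, ?_, ?_⟩
      · rw [cone_iff]
        intro j hj
        rw [ES_perm]
        exact cone_smul _ _ c hcp _ hcone j hj
      · change _ ≤ ES Finset.univ (m+1) ((c • lam) ∘ σ)
        rw [ES_perm, ES_smul, hck, div_mul_cancel₀ _ hS.ne']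
      · rw [hsum]
        congr 1
        have h1 := ES_euler Finset.univ m lam
        have h2 : ∑ i, (((c • lam) ∘ σ) ∘ σ.symm) i * f i = c * ∑ i, lam i * f i := by
          rw [Finset.mul_sum]
          refine Finset.sum_congr rfl fun i _ => ?_
          simp [mul_assoc]
        rw [h2]
        simp only [hf]
        rw [← h1]; push_cast; ring
    · rintro r ⟨mu, hmu, hge, rfl⟩
      rw [hsum]
      refine div_le_div_of_nonneg_right ?_ hn0.le
      refine le_trans ?_ (garding m lam (mu ∘ σ.symm) hcone (hperm mu hmu))
      rw [ES_perm]
      have hge' : (n.choose (m+1) : ℝ) ≤ ES Finset.univ (m+1) mu := hge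
      gcongr
end

section
/- Let k ≥ 2 and let p be a homogeneous real polynomial of degree k on ℝ^N that is hyperbolic at a ∈ ℝ^N. Let x ∈ ℝ^N and let λ_1,…,λ_k ∈ ℝ satisfy p(ta + x) = p(a)·∏_{i=1}^k (t + λ_i) for all t ∈ ℝ, with λ_i > 0 for every i. If (1/k)·p'_x(a)/p(a) = (p(x)/p(a))^{1/k}, then there is a positive constant μ with λ_1 = λ_2 = ⋯ = λ_k = μ; equivalently, all a-eigenvalues of x − μa vanish, i.e., x − μa lies in the edge E_a(p) = {y ∈ ℝ^N : all a-eigenvalues of y are 0}. -/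
/-- A homogeneous polynomial of degree `k` on `ℝ^N` is hyperbolic at `a` if `p(a) > 0`
and for every `x` the polynomial `t ↦ p(t·a + x)` splits with real roots, i.e. there are
real `a`-eigenvalues `λ_1,…,λ_k` of `x` with `p(t·a + x) = p(a)·∏ (t + λ_i)`. -/
def IsHyperbolicAt (N k : ℕ) (p : MvPolynomial (Fin N) ℝ) (a : Fin N → ℝ) : Prop :=
  0 < MvPolynomial.eval a p ∧
    ∀ x : Fin N → ℝ, ∃ lam : Fin k → ℝ,
      ∀ t : ℝ, MvPolynomial.eval (t • a + x) p
        = MvPolynomial.eval a p * ∏ i, (t + lam i)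

open MvPolynomial

theorem eval_smul_of_homog {N k : ℕ} {p : MvPolynomial (Fin N) ℝ} (h : p.IsHomogeneous k)
    (c : ℝ) (v : Fin N → ℝ) : eval (c • v) p = c ^ k * eval v p := by
  rw [eval_eq', eval_eq', Finset.mul_sum]
  refine Finset.sum_congr rfl fun d hd => ?_
  have hdeg : ∑ i, d i = k := by
    have := h (mem_support_iff.mp hd)
    rw [← this]
    simp [Finsupp.weight_apply, Finsupp.sum_fintype]
  simp only [Pi.smul_apply, smul_eq_mul, mul_pow, Finset.prod_mul_distrib,
    Finset.prod_pow_eq_pow_sum, hdeg]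
  ring

/-- **Equality case of Gårding's inequality** (Statement 7). For `k ≥ 2`, `p` homogeneous of
degree `k` and hyperbolic at `a`, with positive `a`-eigenvalues `λ_1,…,λ_k` of `x`: if
`(1/k)·p'_x(a)/p(a) = (p(x)/p(a))^{1/k}` then all `λ_i` equal some `μ > 0`; equivalently
all `a`-eigenvalues of `x − μa` vanish, i.e. `x − μa` lies in the edge `E_a(p)`. -/
theorem garding_equality_case_poly (N k : ℕ) (hk : 2 ≤ k) (p : MvPolynomial (Fin N) ℝ)
    (hhom : p.IsHomogeneous k) (a : Fin N → ℝ) (hyp : IsHyperbolicAt N k p a)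
    (x : Fin N → ℝ) (lam : Fin k → ℝ)
    (hfac : ∀ t : ℝ, eval (t • a + x) p = eval a p * ∏ i, (t + lam i))
    (hpos : ∀ i, 0 < lam i)
    (heq : (1 / k : ℝ) * (deriv (fun t : ℝ => eval (a + t • x) p) 0 / eval a p)
      = (eval x p / eval a p) ^ ((1 : ℝ) / k)) :
    ∃ mu : ℝ, 0 < mu ∧ (∀ i, lam i = mu) ∧
      ∀ lam' : Fin k → ℝ,
        (∀ t : ℝ, eval (t • a + (x - mu • a)) p = eval a p * ∏ i, (t + lam' i)) →
        ∀ i, lam' i = 0 := by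
  have hpa : 0 < eval a p := hyp.1
  have hk0 : (k : ℝ) ≠ 0 := by positivity
  have hkpos : (0 : ℝ) < 1 / k := by positivity
  have hx : eval x p / eval a p = ∏ i, lam i := by
    have := hfac 0
    simp only [zero_smul, zero_add] at this
    rw [this]; field_simp
  have hline : ∀ t : ℝ, eval (a + t • x) p = eval a p * ∏ i, (1 + t * lam i) := by
    intro t
    by_cases ht : t = 0
    · simp [ht]
    · have e : a + t • x = t • (t⁻¹ • a + x) := by
        rw [smul_add, smul_smul, mul_inv_cancel₀ ht, one_smul]
      rw [e, eval_smul_of_homog hhom, hfac]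
      have : ∏ i, (1 + t * lam i) = t ^ k * ∏ i, (t⁻¹ + lam i) := by
        have h2 : ∀ i, 1 + t * lam i = t * (t⁻¹ + lam i) := by
          intro i; field_simp
        simp only [h2, Finset.prod_mul_distrib, Finset.prod_const, Finset.card_univ,
          Fintype.card_fin]
      rw [this]; ring
  have hder : deriv (fun t : ℝ => eval (a + t • x) p) 0 = eval a p * ∑ i, lam i := by
    simp only [hline]
    have h1 : HasDerivAt (fun t : ℝ => ∏ i, (1 + t * lam i)) (∑ i, lam i) 0 := by
      have := HasDerivAt.fun_finsetProd (u := Finset.univ) (x := (0 : ℝ))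
        (f := fun (i : Fin k) (t : ℝ) => 1 + t * lam i) (f' := lam)
        (fun i _ => by simpa using ((hasDerivAt_id (0 : ℝ)).mul_const (lam i)).const_add 1)
      simpa using this
    exact (h1.const_mul _).deriv
  rw [hder, hx, mul_div_cancel_left₀ _ hpa.ne'] at heq
  have key := (Real.geom_mean_eq_arith_mean_weighted_iff_of_pos' Finset.univ
    (fun _ : Fin k => (1 / k : ℝ)) lam (fun _ _ => hkpos) (by simp [hk0])
    (fun i _ => (hpos i).le)).1 (by
      rw [Real.finsetProd_rpow _ _ (fun i _ => (hpos i).le), ← Finset.mul_sum, heq])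
  have key' : ∀ i, lam i = ∑ i, (1 / k : ℝ) * lam i := fun i => key i (Finset.mem_univ i)
  refine ⟨∑ i, (1 / k : ℝ) * lam i, ?_, key', ?_⟩
  · rw [← key' ⟨0, by omega⟩]; exact hpos _
  · generalize ∑ i, (1 / k : ℝ) * lam i = mu at key'
    intro lam' h i
    have h1 := h (-lam' i)
    have e : (-lam' i) • a + (x - mu • a) = (-lam' i - mu) • a + x := by
      rw [sub_smul]; abel
    have h0 : ∏ j, (-lam' i + lam' j) = 0 :=
      Finset.prod_eq_zero (Finset.mem_univ i) (neg_add_cancel _)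
    rw [e, hfac, h0] at h1
    simp only [key', sub_add_cancel, Finset.prod_const, mul_zero] at h1
    have h2 := (mul_eq_zero.1 h1).resolve_left hpa.ne'
    exact neg_eq_zero.1 (eq_zero_of_pow_eq_zero h2)
end

section
/- Let k ≥ 2 and let x_1,…,x_k be nonnegative real numbers. Then (1/k)·Σ_{i=1}^k x_i − (x_1⋯x_k)^{1/k} − (1/k)·Σ_{i=1}^k ( √x_i − (x_1⋯x_k)^{1/(2k)} )² = 2·(x_1⋯x_k)^{1/(2k)}·( (1/k)·Σ_{i=1}^k √x_i − (x_1⋯x_k)^{1/(2k)} ), and this quantity is nonnegative (quantitative Cauchy/AM–GM inequality). -/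
/-- **Quantitative Cauchy/AM–GM inequality** (Statement 9). For `k ≥ 2` nonnegative reals
`x_1,…,x_k`: `(1/k)·Σ x_i − (x_1⋯x_k)^{1/k} − (1/k)·Σ (√x_i − (x_1⋯x_k)^{1/(2k)})²
= 2·(x_1⋯x_k)^{1/(2k)}·((1/k)·Σ √x_i − (x_1⋯x_k)^{1/(2k)})`, and this is nonnegative. -/
theorem quantitative_amgm (k : ℕ) (hk : 2 ≤ k) (x : Fin k → ℝ) (hx : ∀ i, 0 ≤ x i) :
    ((1 / k : ℝ) * ∑ i, x i - (∏ i, x i) ^ ((1 : ℝ) / k)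
        - (1 / k : ℝ) * ∑ i, (Real.sqrt (x i) - (∏ i, x i) ^ ((1 : ℝ) / (2 * k))) ^ 2
      = 2 * (∏ i, x i) ^ ((1 : ℝ) / (2 * k)) *
          ((1 / k : ℝ) * ∑ i, Real.sqrt (x i) - (∏ i, x i) ^ ((1 : ℝ) / (2 * k)))) ∧
    0 ≤ 2 * (∏ i, x i) ^ ((1 : ℝ) / (2 * k)) *
          ((1 / k : ℝ) * ∑ i, Real.sqrt (x i) - (∏ i, x i) ^ ((1 : ℝ) / (2 * k))) := by
  have hk0 : (k : ℝ) ≠ 0 := by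
    have : k ≠ 0 := by omega
    exact_mod_cast this
  have hP : 0 ≤ ∏ i, x i := Finset.prod_nonneg fun i _ => hx i
  have hsq : (∏ i, x i) ^ ((1 : ℝ) / k) = ((∏ i, x i) ^ ((1 : ℝ) / (2 * k))) ^ 2 := by
    rw [← Real.rpow_natCast, ← Real.rpow_mul hP]
    congr 1
    push_cast
    field_simp
  have hle : (∏ i, x i) ^ ((1 : ℝ) / (2 * k)) ≤ (1 / k : ℝ) * ∑ i, Real.sqrt (x i) := by
    have h := Real.geom_mean_le_arith_mean_weighted Finset.univ (fun _ : Fin k => (1 / k : ℝ))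
      (fun i => Real.sqrt (x i)) (fun i _ => by positivity) (by simp [hk0])
      (fun i _ => Real.sqrt_nonneg _)
    rw [← Finset.mul_sum] at h
    refine le_trans (le_of_eq ?_) h
    rw [← Real.finsetProd_rpow _ _ (fun i _ => hx i)]
    refine Finset.prod_congr rfl fun i _ => ?_
    rw [Real.sqrt_eq_rpow, ← Real.rpow_mul (hx i)]
    congr 1
    field_simp
  have hg : 0 ≤ (∏ i, x i) ^ ((1 : ℝ) / (2 * k)) := Real.rpow_nonneg hP _
  rw [hsq]
  generalize (∏ i, x i) ^ ((1 : ℝ) / (2 * k)) = g at *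
  refine ⟨?_, mul_nonneg (by positivity) (sub_nonneg.2 hle)⟩
  have hs : ∑ i, (Real.sqrt (x i) - g) ^ 2
      = ∑ i, x i - 2 * g * ∑ i, Real.sqrt (x i) + k * g ^ 2 := by
    have : ∀ i, (Real.sqrt (x i) - g) ^ 2 = x i - 2 * g * Real.sqrt (x i) + g ^ 2 := by
      intro i
      rw [sub_sq, Real.sq_sqrt (hx i)]
      ring
    simp only [this, Finset.sum_add_distrib, Finset.sum_sub_distrib, Finset.mul_sum]
    simp
  rw [hs]
  field_simp
  ring
end

section
/- Let p be a homogeneous real polynomial of degree k on ℝ^N that is hyperbolic at a ∈ ℝ^N, and assume its edge at a is trivial: the only y ∈ ℝ^N all of whose a-eigenvalues are zero is y = 0. Let (b^{(m)}) be a sequence in ℝ^N and for each m let λ^{(m)} = (λ^{(m)}_1,…,λ^{(m)}_k) ∈ ℝ^k satisfy p(ta + b^{(m)}) = p(a)·∏_{i=1}^k (t + λ^{(m)}_i) for all t ∈ ℝ. If λ^{(m)}_i → 0 as m → ∞ for every i = 1,…,k, then b^{(m)} → 0 as m → ∞. -/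
open MvPolynomial Filter

/-- **Convergence from vanishing eigenvalues** (Statement 11). Let `p` be homogeneous of
degree `k` and hyperbolic at `a`, with trivial edge at `a` (the only point all of whose
`a`-eigenvalues vanish is `0`). If `b^{(m)}` is a sequence whose `a`-eigenvalues
`λ^{(m)}_i` all tend to `0`, then `b^{(m)} → 0`. -/
theorem tendsto_zero_of_eigenvalues_tendsto_zero (N k : ℕ) (p : MvPolynomial (Fin N) ℝ)
    (hhom : p.IsHomogeneous k) (a : Fin N → ℝ) (hyp : IsHyperbolicAt N k p a)
    (hedge : ∀ y : Fin N → ℝ, ∀ lam' : Fin k → ℝ,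
      (∀ t : ℝ, eval (t • a + y) p = eval a p * ∏ i, (t + lam' i)) →
      (∀ i, lam' i = 0) → y = 0)
    (b : ℕ → Fin N → ℝ) (lam : ℕ → Fin k → ℝ)
    (hfac : ∀ m, ∀ t : ℝ, eval (t • a + b m) p = eval a p * ∏ i, (t + lam m i))
    (hconv : ∀ i, Tendsto (fun m => lam m i) atTop (nhds 0)) :
    Tendsto b atTop (nhds 0) := by
  by_contra hb
  rw [NormedAddGroup.tendsto_nhds_zero] at hb
  push Not at hb
  obtain ⟨ε, hε, hf⟩ := hb
  obtain ⟨φ, hφ, hφε⟩ := Filter.extraction_of_frequently_atTop hf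
  have hpos : ∀ n, 0 < ‖b (φ n)‖ := fun n => lt_of_lt_of_le hε (hφε n)
  obtain ⟨y, hy, ψ, hψ, hlim⟩ := (isCompact_sphere (0 : Fin N → ℝ) 1).tendsto_subseq
    (x := fun n => ‖b (φ n)‖⁻¹ • b (φ n)) (by
      intro n
      simp [norm_smul, (hpos n).ne'])
  have hscale : ∀ n, ∀ t : ℝ, eval (t • a + ‖b (φ n)‖⁻¹ • b (φ n)) p
      = eval a p * ∏ i, (t + ‖b (φ n)‖⁻¹ * lam (φ n) i) := by
    intro n t
    have hne := (hpos n).ne'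
    have h1 : t • a + ‖b (φ n)‖⁻¹ • b (φ n)
        = ‖b (φ n)‖⁻¹ • ((‖b (φ n)‖ * t) • a + b (φ n)) := by
      rw [smul_add, smul_smul, inv_mul_cancel_left₀ hne]
    have h2 : ∀ (r : ℝ) (x : Fin N → ℝ), eval (r • x) p = r ^ k * eval x p := by
      intro r x
      simp only [eval_eq, Finset.mul_sum]
      refine Finset.sum_congr rfl fun d hd => ?_
      have hdeg : ∑ i, d i = k := by
        have := hhom (mem_support_iff.mp hd)
        rw [← this, Finsupp.weight_apply, Finsupp.sum_fintype] <;> simp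
      have hdeg' : ∑ i ∈ d.support, d i = k := by
        rw [← hdeg]
        exact Finset.sum_subset (Finset.subset_univ _) (by simp)
      simp only [Pi.smul_apply, smul_eq_mul, mul_pow, Finset.prod_mul_distrib,
        Finset.prod_pow_eq_pow_sum, hdeg']
      ring
    have h3 : ∀ i, t + ‖b (φ n)‖⁻¹ * lam (φ n) i
        = ‖b (φ n)‖⁻¹ * (‖b (φ n)‖ * t + lam (φ n) i) := by
      intro i
      rw [mul_add, inv_mul_cancel_left₀ hne]
    simp only [h3]
    rw [h1, h2, hfac, Finset.prod_mul_distrib]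
    simp
    ring
  have hev : ∀ i, Tendsto (fun n => ‖b (φ n)‖⁻¹ * lam (φ n) i) atTop (nhds 0) := by
    intro i
    have hl : Tendsto (fun n => ε⁻¹ * |lam (φ n) i|) atTop (nhds 0) := by
      simpa using (((hconv i).comp hφ.tendsto_atTop).abs).const_mul ε⁻¹
    refine squeeze_zero_norm (fun n => ?_) hl
    rw [norm_mul, norm_inv, norm_norm, Real.norm_eq_abs]
    have := hφε n
    gcongr
  have hy0 : y = 0 := by
    refine hedge y (fun _ => 0) (fun t => ?_) (fun _ => rfl)
    have hL : Tendsto (fun n => eval (t • a + ‖b (φ (ψ n))‖⁻¹ • b (φ (ψ n))) p) atTop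
        (nhds (eval (t • a + y) p)) :=
      ((MvPolynomial.continuous_eval p).tendsto _).comp (tendsto_const_nhds.add hlim)
    have hR : Tendsto (fun n => eval a p *
        ∏ i, (t + ‖b (φ (ψ n))‖⁻¹ * lam (φ (ψ n)) i)) atTop
        (nhds (eval a p * ∏ _i : Fin k, (t + 0))) :=
      (tendsto_finsetProd _ fun i _ =>
        tendsto_const_nhds.add ((hev i).comp hψ.tendsto_atTop)).const_mul _
    refine tendsto_nhds_unique hL ?_
    simpa only [hscale] using hR
  simp [hy0] at hy
end

section
/- Let n ≥ 2, 1 ≤ k ≤ n, let A be a real symmetric n×n matrix, and let λ_1,…,λ_k be real numbers such that S_k(t·I_n + A) = C(n,k)·∏_{i=1}^k (t + λ_i) for all t ∈ ℝ. Then λ_i > 0 for all i = 1,…,k if and only if σ_j(λ(A)) > 0 for all j = 1,…,k (i.e., λ(A) ∈ Γ_k). -/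
open Polynomial in
lemma sigmaE_eq_coeff {n : ℕ} (mu : Fin n → ℝ) (j : ℕ) (hj : j ≤ n) :
    (∏ i, (X + C (mu i))).coeff (n - j) = sigmaE j mu := by
  rw [Finset.prod_X_add_C_coeff _ _ (by simp)]
  simp [sigmaE, Nat.sub_sub_self hj]

open Polynomial in
lemma prod_eigenvalues_shift {n : ℕ} (A : Matrix (Fin n) (Fin n) ℝ) (hA : A.IsHermitian) (t : ℝ)
    (hB : (t • (1 : Matrix (Fin n) (Fin n) ℝ) + A).IsHermitian) :
    ∏ i, (X + C (hB.eigenvalues i)) = taylor t (∏ i, (X + C (hA.eigenvalues i))) := by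
  have h := Matrix.charpoly_sub_scalar A (-t)
  have e : A - Matrix.scalar (Fin n) (-t) = t • (1 : Matrix (Fin n) (Fin n) ℝ) + A := by
    rw [Matrix.smul_one_eq_diagonal, add_comm]
    simp [sub_eq_add_neg]
  rw [e, hB.charpoly_eq, hA.charpoly_eq] at h
  apply Polynomial.funext
  intro x
  have h2 := congrArg (eval (-x)) h
  simp only [eval_prod, eval_comp, eval_sub, eval_X, eval_C, eval_add, taylor_apply,
    RCLike.ofReal_real_eq_id, id] at h2 ⊢
  have e1 : ∀ i, -x - hB.eigenvalues i = -1 * (x + hB.eigenvalues i) := fun i => by ring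
  have e2 : ∀ i, -x + -t - hA.eigenvalues i = -1 * (x + t + hA.eigenvalues i) := fun i => by ring
  simp only [e1, e2, Finset.prod_mul_distrib] at h2
  exact mul_left_cancel₀ (by simp) h2

open Polynomial in
lemma sigma_relation (n k : ℕ) (hkn : k ≤ n)
    (A : Matrix (Fin n) (Fin n) ℝ) (hA : A.IsHermitian) (lam : Fin k → ℝ)
    (hfac : ∀ t : ℝ, SkM k (t • (1 : Matrix (Fin n) (Fin n) ℝ) + A)
      = (n.choose k : ℝ) * ∏ i, (t + lam i)) (j : ℕ) (hj : j ≤ k) :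
    ((n - j).choose (n - k) : ℝ) * sigmaE j hA.eigenvalues = (n.choose k : ℝ) * sigmaE j lam := by
  have key : hasseDeriv (n - k) (∏ i, (X + C (hA.eigenvalues i)))
      = C (n.choose k : ℝ) * ∏ i, (X + C (lam i)) := by
    apply Polynomial.funext
    intro t
    have hB : (t • (1 : Matrix (Fin n) (Fin n) ℝ) + A).IsHermitian := by
      refine Matrix.IsHermitian.add ?_ hA
      simp [Matrix.IsHermitian]
    rw [← taylor_coeff, ← prod_eigenvalues_shift A hA t hB, sigmaE_eq_coeff _ _ hkn]
    have := hfac t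
    rw [SkM, dif_pos hB] at this
    rw [this]
    simp [eval_prod]
  have h := congrArg (fun p => coeff p (k - j)) key
  simp only [hasseDeriv_coeff, coeff_C_mul] at h
  rw [sigmaE_eq_coeff lam j hj, show k - j + (n - k) = n - j by omega,
    sigmaE_eq_coeff _ j (hj.trans hkn)] at h
  exact h

lemma sigmaE_zero {n : ℕ} (mu : Fin n → ℝ) : sigmaE 0 mu = 1 := by simp [sigmaE]

open Polynomial in
lemma pos_iff_sigma {k : ℕ} (lam : Fin k → ℝ) :
    (∀ i, 0 < lam i) ↔ lam ∈ GardingCone k k := by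
  constructor
  · intro h j _ hj
    refine Finset.sum_pos (fun s _ => Finset.prod_pos fun i _ => h i) ?_
    exact Finset.powersetCard_nonempty.2 (by simpa using hj)
  · intro h i
    by_contra hi
    have hpos : ∀ m, m ≤ k → 0 < (∏ i, (X + C (lam i))).coeff m := by
      intro m hm
      have := sigmaE_eq_coeff lam (k - m) (by omega)
      rw [Nat.sub_sub_self hm] at this
      rw [this]
      rcases Nat.eq_zero_or_pos (k - m) with h0 | h0
      · rw [h0, sigmaE_zero]; exact one_pos
      · exact h _ h0 (by omega)
    have hz : (∏ i, (X + C (lam i))).eval (-lam i) = 0 := by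
      rw [eval_prod]
      exact Finset.prod_eq_zero (Finset.mem_univ i) (by simp)
    have hd : (∏ i, (X + C (lam i))).natDegree = k := by
      rw [natDegree_prod_of_monic _ _ (fun i _ => monic_X_add_C _)]
      simp
    rw [eval_eq_sum_range, hd] at hz
    have ht : 0 ≤ -lam i := by linarith
    have : 0 < ∑ m ∈ Finset.range (k + 1), (∏ i, (X + C (lam i))).coeff m * (-lam i) ^ m := by
      refine Finset.sum_pos' (fun m hm => ?_) ⟨0, by simp, ?_⟩
      · exact mul_nonneg (hpos m (by simpa [Nat.lt_succ_iff] using hm)).le (pow_nonneg ht m)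
      · simpa using hpos 0 (by omega)
    linarith

/-- **Positivity of the `I_n`-eigenvalues characterizes the Gårding cone** (Statement 12).
If `S_k(t·I_n + A) = C(n,k)·∏ (t + λ_i)` for all `t ∈ ℝ`, then `λ_i > 0` for all `i` iff
`λ(A) ∈ Γ_k`. -/
theorem eigenvalues_pos_iff_gardingCone (n k : ℕ) (hn : 2 ≤ n) (hk1 : 1 ≤ k) (hkn : k ≤ n)
    (A : Matrix (Fin n) (Fin n) ℝ) (hA : A.IsHermitian) (lam : Fin k → ℝ)
    (hfac : ∀ t : ℝ, SkM k (t • (1 : Matrix (Fin n) (Fin n) ℝ) + A)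
      = (n.choose k : ℝ) * ∏ i, (t + lam i)) :
    (∀ i, 0 < lam i) ↔ hA.eigenvalues ∈ GardingCone n k := by
  rw [pos_iff_sigma]
  refine forall_congr' fun j => forall_congr' fun _ => forall_congr' fun hj => ?_
  have h := sigma_relation n k hkn A hA lam hfac j hj
  have c1 : (0 : ℝ) < ((n - j).choose (n - k) : ℝ) := by
    exact_mod_cast Nat.choose_pos (by omega)
  have c2 : (0 : ℝ) < (n.choose k : ℝ) := by exact_mod_cast Nat.choose_pos hkn
  rw [← mul_pos_iff_of_pos_left c2, ← h, mul_pos_iff_of_pos_left c1]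
end

section
/- For integers n ≥ 2 and 1 ≤ k ≤ n−1, one has (1/n)·C(n,k)^{1/k} > (1/n)·C(n,k+1)^{1/(k+1)}; equivalently, writing c(n,k) = (1/n)·C(n,k)^{1/k}, the quantity [c(n,k)/c(n,k+1)]^{k(k+1)} = C(n,k)·(k+1)^k/(n−k)^k = n(n−1)⋯(n−k+1)·(k+1)^k/((n−k)^k·k!) is strictly greater than 1. -/
/-- **Monotonicity of `c(n,k) = (1/n)·C(n,k)^{1/k}`** (Statement 14). For `2 ≤ n` and
`1 ≤ k ≤ n−1`: `c(n,k) > c(n,k+1)`; equivalently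
`[c(n,k)/c(n,k+1)]^{k(k+1)} = C(n,k)·(k+1)^k/(n−k)^k > 1`. -/
theorem cnk_strict_anti (n k : ℕ) (hn : 2 ≤ n) (hk1 : 1 ≤ k) (hkn : k + 1 ≤ n) :
    ((1 / n : ℝ) * (n.choose (k + 1) : ℝ) ^ ((1 : ℝ) / (k + 1))
        < (1 / n : ℝ) * (n.choose k : ℝ) ^ ((1 : ℝ) / k)) ∧
    (((1 / n : ℝ) * (n.choose k : ℝ) ^ ((1 : ℝ) / k)
          / ((1 / n : ℝ) * (n.choose (k + 1) : ℝ) ^ ((1 : ℝ) / (k + 1)))) ^ (k * (k + 1))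
      = (n.choose k : ℝ) * ((k : ℝ) + 1) ^ k / ((n : ℝ) - k) ^ k) ∧
    1 < (n.choose k : ℝ) * ((k : ℝ) + 1) ^ k / ((n : ℝ) - k) ^ k := by
  have hC : 0 < n.choose k := Nat.choose_pos (by omega)
  have hD : 0 < n.choose (k + 1) := Nat.choose_pos hkn
  have hCr : (0 : ℝ) < n.choose k := by exact_mod_cast hC
  have hDr : (0 : ℝ) < n.choose (k + 1) := by exact_mod_cast hD
  have hnr : (0 : ℝ) < n := by exact_mod_cast (by omega : 0 < n)
  have hkr : (0 : ℝ) < k := by exact_mod_cast hk1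
  have hcast : ((n - k : ℕ) : ℝ) = (n : ℝ) - k := Nat.cast_sub (by omega)
  have hnk : (0 : ℝ) < (n : ℝ) - k := by
    rw [← hcast]; exact_mod_cast (by omega : 0 < n - k)
  have hnat : (n - k) ^ k < n.choose k * (k + 1) ^ k := by
    calc (n - k) ^ k < (n + 1 - k) ^ k := Nat.pow_lt_pow_left (by omega) (by omega)
      _ ≤ n.descFactorial k := Nat.pow_sub_le_descFactorial n k
      _ = n.choose k * k.factorial := by
        rw [Nat.descFactorial_eq_factorial_mul_choose, mul_comm]
      _ ≤ n.choose k * (k + 1) ^ k := by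
        apply Nat.mul_le_mul_left
        exact (Nat.factorial_le_pow k).trans (Nat.pow_le_pow_left (by omega) k)
  have h3 : 1 < (n.choose k : ℝ) * ((k : ℝ) + 1) ^ k / ((n : ℝ) - k) ^ k := by
    rw [one_lt_div (pow_pos hnk k), ← hcast]
    exact_mod_cast hnat
  have hrec : (n.choose (k + 1) : ℝ) = n.choose k * ((n : ℝ) - k) / (k + 1) := by
    rw [eq_div_iff (by positivity), ← hcast]
    exact_mod_cast Nat.choose_succ_right_eq n k
  set A : ℝ := (n.choose k : ℝ) ^ ((1 : ℝ) / k) with hA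
  set B : ℝ := (n.choose (k + 1) : ℝ) ^ ((1 : ℝ) / (k + 1)) with hB
  have hA0 : 0 < A := Real.rpow_pos_of_pos hCr _
  have hB0 : 0 < B := Real.rpow_pos_of_pos hDr _
  have hAk : A ^ k = n.choose k := by
    rw [hA, one_div]
    exact Real.rpow_inv_natCast_pow hCr.le (by omega)
  have hBk : B ^ (k + 1) = n.choose (k + 1) := by
    rw [hB, one_div]
    have := Real.rpow_inv_natCast_pow hDr.le (n := k + 1) (by omega)
    push_cast at this
    exact this
  have h2 : ((1 / n : ℝ) * A / ((1 / n : ℝ) * B)) ^ (k * (k + 1))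
      = (n.choose k : ℝ) * ((k : ℝ) + 1) ^ k / ((n : ℝ) - k) ^ k := by
    rw [mul_div_mul_left _ _ (by positivity), div_pow, pow_mul, hAk, mul_comm k (k + 1),
      pow_mul, hBk, hrec, div_pow, mul_pow]
    have := hnk.ne'
    field_simp
    exact pow_succ _ _
  refine ⟨?_, h2, h3⟩
  have hr : 1 < (1 / n : ℝ) * A / ((1 / n : ℝ) * B) := by
    by_contra hcon
    have := pow_le_one₀ (n := k * (k + 1)) (by positivity) (not_lt.mp hcon)
    rw [h2] at this
    linarith
  rwa [one_lt_div (by positivity)] at hr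
end

section
/- Let n ≥ 2 and 1 ≤ k ≤ n−1. If λ ∈ Γ_k^* and ρ_k^*(λ) ≥ (1/n)·C(n,k)^{1/k}, then λ ∈ Γ_{k+1}^* and ρ_{k+1}^*(λ) ≥ (1/n)·C(n,k)^{1/k} > (1/n)·C(n,k+1)^{1/(k+1)}. (In particular the sets V_k = {λ ∈ Γ_k^* : ρ_k^*(λ) ≥ (1/n)C(n,k)^{1/k}} satisfy V_1 ⊂ V_2 ⊂ ⋯ ⊂ V_n.) -/
open Polynomial in
lemma splits_derivative_aux {p : ℝ[X]} (hp : p.Splits) : (derivative p).Splits := by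
  rw [splits_iff_card_roots] at hp ⊢
  have h1 := card_roots_le_derivative p
  have h2 := card_roots' (derivative p)
  have h3 := natDegree_derivative_le p
  omega

open Polynomial in
lemma splits_iterate_aux {p : ℝ[X]} (hp : p.Splits) (m : ℕ) : (derivative^[m] p).Splits := by
  induction m with
  | zero => simpa using hp
  | succ m ih =>
    rw [Function.iterate_succ_apply']
    exact splits_derivative_aux ih

open Polynomial in
lemma splits_reverse_aux {p : ℝ[X]} (hp : p.Splits) : p.reverse.Splits := by
  unfold Splits at hp
  induction hp using Submonoid.closure_induction with
  | mem x hx =>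
    rcases hx with ⟨a, rfl⟩ | ⟨a, rfl⟩
    · simp
    · apply Splits.of_natDegree_le_one
      exact (reverse_natDegree_le _).trans (by simp)
  | one =>
    rw [← C_1, reverse_C]
    exact Splits.C _
  | mul x y _ _ hx hy =>
    rw [reverse_mul_of_domain]
    exact hx.mul hy

open Polynomial in
lemma disc_aux {q : ℝ[X]} (hq : q.Splits) (hd : q.natDegree ≤ 2) :
    4 * q.coeff 0 * q.coeff 2 ≤ q.coeff 1 ^ 2 := by
  by_cases h2 : q.coeff 2 = 0
  · rw [h2, mul_zero]; positivity
  have hdeg : q.natDegree = 2 := le_antisymm hd (le_natDegree_of_ne_zero h2)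
  obtain ⟨x, hx⟩ := hq.exists_eval_eq_zero (by
    intro h
    have h' : q.natDegree = 0 := natDegree_eq_of_degree_eq_some h
    omega)
  rw [eval_eq_sum_range, hdeg] at hx
  simp only [Finset.sum_range_succ, Finset.sum_range_zero] at hx
  have : q.coeff 1 ^ 2 - 4 * q.coeff 0 * q.coeff 2 = (2 * q.coeff 2 * x + q.coeff 1) ^ 2 := by
    linear_combination (-4 * q.coeff 2) * hx
  nlinarith [sq_nonneg (2 * q.coeff 2 * x + q.coeff 1)]

open Polynomial in
lemma coeff_aux {n : ℕ} (mu : Fin n → ℝ) (t : ℕ) (ht : t ≤ n) :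
    (∏ i, (X + C (mu i))).coeff (n - t) = sigmaE t mu := by
  have h := Finset.prod_X_add_C_coeff (Finset.univ : Finset (Fin n)) mu (k := n - t) (by simp)
  rw [h]
  simp only [Finset.card_univ, Fintype.card_fin, Nat.sub_sub_self ht]
  rfl

/-- scaled normalised symmetric function -/
noncomputable def pE {n : ℕ} (t : ℕ) (mu : Fin n → ℝ) : ℝ :=
  (t.factorial : ℝ) * ((n - t).factorial : ℝ) * sigmaE t mu

open Polynomial in
lemma newton_aux (i m n : ℕ) (hn : n = m + i + 2) (mu : Fin n → ℝ) :
    pE i mu * pE (i + 2) mu ≤ pE (i + 1) mu ^ 2 := by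
  set P : ℝ[X] := ∏ i, (X + C (mu i)) with hP
  have hPs : P.Splits := Splits.prod fun i _ => Splits.X_add_C _
  have hPd : P.natDegree = n := by
    rw [hP, natDegree_prod_of_monic _ _ (fun i _ => monic_X_add_C _)]
    simp
  have hc : ∀ s ≤ 2, P.coeff (2 - s + m) = sigmaE (i + s) mu := by
    intro s hs
    rw [← coeff_aux mu (i + s) (by omega)]
    congr 1
    omega
  set D := derivative^[m] P with hD
  have hDn : D.natDegree = i + 2 := by
    apply le_antisymm
    · refine (natDegree_iterate_derivative P m).trans ?_
      omega
    · apply le_natDegree_of_ne_zero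
      rw [hD, coeff_iterate_derivative]
      have h1 : i + 2 + m = n := by omega
      have h2 : P.coeff n = 1 := by
        have := coeff_aux mu 0 (by omega)
        simpa [sigmaE] using this
      rw [h1, h2]
      have : n.descFactorial m ≠ 0 := by
        rw [Ne, Nat.descFactorial_eq_zero_iff_lt]; omega
      simpa using this
  have hQs : (derivative^[i] D.reverse).Splits :=
    splits_iterate_aux (splits_reverse_aux (splits_iterate_aux hPs m)) i
  have hQd : (derivative^[i] D.reverse).natDegree ≤ 2 := by
    refine (natDegree_iterate_derivative _ i).trans ?_
    have := reverse_natDegree_le D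
    omega
  have hQc : ∀ s ≤ 2, (derivative^[i] D.reverse).coeff s =
      ((s + i).descFactorial i : ℝ) * (((2 - s + m).descFactorial m : ℝ) * sigmaE (i + s) mu) := by
    intro s hs
    rw [coeff_iterate_derivative, coeff_reverse, hDn, revAt_le (by omega),
      show i + 2 - (s + i) = 2 - s by omega, hD, coeff_iterate_derivative, hc s hs]
    simp [nsmul_eq_mul]
  have hdf : ∀ a b : ℕ, (b.factorial : ℝ) * ((b + a).descFactorial a : ℝ) = (b + a).factorial := by
    intro a b
    have := Nat.factorial_mul_descFactorial (n := b + a) (k := a) (by omega)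
    rw [Nat.add_sub_cancel] at this
    exact_mod_cast this
  have key := disc_aux hQs hQd
  rw [hQc 0 (by omega), hQc 1 (by omega), hQc 2 (by omega)] at key
  have a0 := hdf i 0
  have a1 := hdf i 1
  have a2 := hdf i 2
  have b0 := hdf m 0
  have b1 := hdf m 1
  have b2 := hdf m 2
  simp only [Nat.factorial_zero, Nat.factorial_one, Nat.factorial_two, Nat.cast_one, one_mul,
    Nat.cast_ofNat] at a0 a1 a2 b0 b1 b2
  unfold pE
  rw [show n - i = 2 + m by omega, show n - (i + 1) = 1 + m by omega,
    show n - (i + 2) = 0 + m by omega, show i + 2 = 2 + i by omega, show i + 1 = 1 + i by omega,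
    ← b0, ← b1, ← b2, ← a1, ← a2]
  rw [show (i.factorial : ℝ) = ((0 + i).descFactorial i : ℝ) by rw [a0, zero_add]]
  simp only [Nat.sub_zero, Nat.sub_self, show 2 - 1 = 1 from rfl, add_zero,
    show i + 2 = 2 + i by omega, show i + 1 = 1 + i by omega] at key
  linarith [key]

lemma maclaurin_aux (n k : ℕ) (hkn : k + 1 ≤ n) (mu : Fin n → ℝ)
    (hmu : mu ∈ GardingCone n (k + 1)) (h : (n.choose (k + 1) : ℝ) ≤ sigmaE (k + 1) mu) :
    (n.choose k : ℝ) ≤ sigmaE k mu := by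
  have hpos : ∀ j ≤ k + 1, 0 < pE j mu := by
    intro j hj
    have : 0 < sigmaE j mu := by
      rcases Nat.eq_zero_or_pos j with rfl | h0
      · simp [sigmaE]
      · exact hmu j h0 hj
    unfold pE
    positivity
  have hch : ∀ j ≤ n, ((j.factorial : ℝ) * ((n - j).factorial : ℝ)) * (n.choose j : ℝ)
      = n.factorial := by
    intro j hj
    have := Nat.choose_mul_factorial_mul_factorial hj
    rw [← this]; push_cast; ring
  have h0 : pE 0 mu = n.factorial := by simp [pE, sigmaE]
  have h1 : (n.factorial : ℝ) ≤ pE (k + 1) mu := by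
    rw [← hch (k + 1) hkn]
    exact mul_le_mul_of_nonneg_left h (by positivity)
  have hfin : (n.factorial : ℝ) ≤ pE k mu := by
    by_contra hlt
    push Not at hlt
    have hstep : ∀ d ≤ k, pE (k - d) mu < pE (k - d + 1) mu := by
      intro d
      induction d with
      | zero => intro _; simpa using hlt.trans_le h1
      | succ d ih =>
        intro hd
        have h2 := ih (by omega)
        obtain ⟨i, hi⟩ : ∃ i, i = k - (d + 1) := ⟨_, rfl⟩
        rw [← hi]
        rw [show k - d = i + 1 by omega] at h2
        have h3 := newton_aux i (n - i - 2) n (by omega) mu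
        have p0 := hpos i (by omega)
        have p1 := hpos (i + 1) (by omega)
        by_contra hc
        push Not at hc
        have : pE (i + 1) mu * pE (i + 1) mu < pE i mu * pE (i + 2) mu :=
          mul_lt_mul' hc h2 p1.le p0
        nlinarith
    have hall : ∀ j ≤ k, (n.factorial : ℝ) ≤ pE j mu := by
      intro j
      induction j with
      | zero => intro _; rw [h0]
      | succ j ih =>
        intro hj
        have h2 := hstep (k - j) (by omega)
        rw [show k - (k - j) = j by omega] at h2
        exact (ih (by omega)).trans h2.le
    exact absurd (hall k le_rfl) (not_le.mpr hlt)
  rw [← hch k (by omega)] at hfin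
  exact le_of_mul_le_mul_left hfin (by positivity)

lemma choose_strict_aux (n k : ℕ) (hk1 : 1 ≤ k) (hkn : k + 1 ≤ n) :
    (n.choose (k + 1)) ^ k < (n.choose k) ^ (k + 1) := by
  have hc : 0 < n.choose k := Nat.choose_pos (by omega)
  have e1 := Nat.choose_succ_right_eq n k
  have e2 : (n - k) ^ k < (k + 1) ^ k * n.choose k := by
    calc (n - k) ^ k < (n + 1 - k) ^ k := Nat.pow_lt_pow_left (by omega) (by omega)
      _ ≤ n.descFactorial k := Nat.pow_sub_le_descFactorial n k
      _ = k.factorial * n.choose k := Nat.descFactorial_eq_factorial_mul_choose n k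
      _ ≤ (k + 1) ^ k * n.choose k := by
        gcongr
        exact (Nat.factorial_le_pow k).trans (Nat.pow_le_pow_left (by omega) k)
  have e3 : (n.choose (k + 1)) ^ k * (k + 1) ^ k < (n.choose k) ^ (k + 1) * (k + 1) ^ k := by
    rw [← mul_pow, e1, mul_pow, pow_succ, mul_assoc]
    apply Nat.mul_lt_mul_of_pos_left _ (by positivity)
    rw [mul_comm (n.choose k)]; exact e2
  exact lt_of_mul_lt_mul_right e3 (Nat.zero_le _)

/-- **Monotonicity of the classes `V_k`** (Statement 15). For `1 ≤ k ≤ n−1`: if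
`λ ∈ Γ_k^*` and `ρ_k^*(λ) ≥ (1/n)·C(n,k)^{1/k}`, then `λ ∈ Γ_{k+1}^*` with
`ρ_{k+1}^*(λ) ≥ (1/n)·C(n,k)^{1/k} > (1/n)·C(n,k+1)^{1/(k+1)}`; hence `V_k ⊆ V_{k+1}`. -/
theorem Vk_mono (n k : ℕ) (hn : 2 ≤ n) (hk1 : 1 ≤ k) (hkn : k + 1 ≤ n)
    (lam : Fin n → ℝ) (hmem : lam ∈ GardingDual n k)
    (hrho : (1 / n : ℝ) * (n.choose k : ℝ) ^ ((1 : ℝ) / k) ≤ rhoStar n k lam) :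
    lam ∈ GardingDual n (k + 1) ∧
    (1 / n : ℝ) * (n.choose k : ℝ) ^ ((1 : ℝ) / k) ≤ rhoStar n (k + 1) lam ∧
    (1 / n : ℝ) * (n.choose (k + 1) : ℝ) ^ ((1 : ℝ) / (k + 1))
      < (1 / n : ℝ) * (n.choose k : ℝ) ^ ((1 : ℝ) / k) := by
  have hsub : ∀ mu ∈ GardingCone n (k + 1), mu ∈ GardingCone n k :=
    fun mu hmu j h1 h2 => hmu j h1 (by omega)
  refine ⟨fun mu hmu => hmem mu (hsub mu hmu), ?_, ?_⟩
  · refine hrho.trans ?_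
    unfold rhoStar
    apply le_csInf
    · have hone : ∀ j, sigmaE j (fun _ : Fin n => (1 : ℝ)) = n.choose j := by
        intro j; simp [sigmaE]
      refine ⟨_, fun _ => 1, ?_, ?_, rfl⟩
      · intro j _ hj
        rw [hone]
        exact_mod_cast Nat.choose_pos (by omega)
      · rw [hone]
    · rintro r ⟨mu, hmu, hs, rfl⟩
      apply csInf_le
      · refine ⟨0, ?_⟩
        rintro r ⟨nu, hnu, _, rfl⟩
        exact div_nonneg (hmem nu hnu) (Nat.cast_nonneg n)
      · exact ⟨mu, hsub mu hmu, maclaurin_aux n k hkn mu hmu hs, rfl⟩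
  · have hnpos : (0 : ℝ) < 1 / n := by
      have : (0 : ℝ) < n := by exact_mod_cast (by omega : 0 < n)
      positivity
    apply mul_lt_mul_of_pos_left _ hnpos
    have hk : (0 : ℝ) < k := by exact_mod_cast hk1
    have hA : (0 : ℝ) ≤ (n.choose (k + 1) : ℝ) := Nat.cast_nonneg _
    have hB : (0 : ℝ) ≤ (n.choose k : ℝ) := Nat.cast_nonneg _
    have hs : ((n.choose (k + 1) : ℝ)) ^ k < (n.choose k : ℝ) ^ (k + 1) := by
      exact_mod_cast choose_strict_aux n k hk1 hkn
    have h := Real.rpow_lt_rpow (by positivity) hs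
      (show (0 : ℝ) < 1 / (k * (k + 1)) by positivity)
    rw [← Real.rpow_natCast, ← Real.rpow_natCast, ← Real.rpow_mul hA, ← Real.rpow_mul hB] at h
    have e1 : (k : ℝ) * (1 / (k * (k + 1))) = 1 / (k + 1) := by field_simp
    have e2 : ((k + 1 : ℕ) : ℝ) * (1 / (k * (k + 1))) = 1 / k := by push_cast; field_simp
    rwa [e1, e2] at h
end

section
/- Let n ≥ 2. Then λ ∈ Γ_n^* if and only if λ_i ≥ 0 for every i = 1,…,n (i.e., Γ_n^* is the closed nonnegative orthant, which is the closure of Γ_n); moreover, for every λ ∈ Γ_n^*, ρ_n^*(λ) = (λ_1·λ_2⋯λ_n)^{1/n}. -/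
open Filter Topology in
lemma gardingCone_top_eq (n : ℕ) (hn : 2 ≤ n) :
    GardingCone n n = Set.pi Set.univ (fun _ : Fin n => Set.Ioi (0 : ℝ)) := by
  ext mu
  simp only [GardingCone, Set.mem_ofPred_eq, Set.mem_pi, Set.mem_univ, Set.mem_Ioi, true_imp_iff]
  constructor
  · intro h i
    by_contra hi
    push Not at hi
    have h0 : ∏ j, (mu j + (- mu i)) = 0 :=
      Finset.prod_eq_zero (Finset.mem_univ i) (by ring)
    rw [Finset.prod_add, Finset.sum_powerset] at h0
    have h1 : ∀ j ∈ Finset.range ((Finset.univ : Finset (Fin n)).card + 1),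
        ∑ s ∈ Finset.powersetCard j (Finset.univ : Finset (Fin n)),
          (∏ k ∈ s, mu k) * ∏ k ∈ Finset.univ \ s, (- mu i) = sigmaE j mu * (- mu i) ^ (n - j) := by
      intro j _
      rw [sigmaE, Finset.sum_mul]
      refine Finset.sum_congr rfl fun s hs => ?_
      rw [Finset.mem_powersetCard] at hs
      rw [Finset.prod_const, Finset.card_sdiff_of_subset hs.1, hs.2]
      simp
    rw [Finset.sum_congr rfl h1, Finset.card_univ, Fintype.card_fin] at h0
    have h2 : 0 < ∑ j ∈ Finset.range (n + 1), sigmaE j mu * (- mu i) ^ (n - j) := by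
      refine Finset.sum_pos' (fun j hj => ?_) ⟨n, by simp, ?_⟩
      · refine mul_nonneg ?_ (pow_nonneg (by linarith) _)
        rcases Nat.eq_zero_or_pos j with rfl | hj0
        · simp [sigmaE]
        · exact (h j hj0 (by simpa [Nat.lt_succ_iff] using hj)).le
      · simpa using h n (by omega) le_rfl
    linarith
  · intro h j _ hj
    refine Finset.sum_pos (fun s _ => Finset.prod_pos fun i _ => h i) ?_
    rw [Finset.powersetCard_nonempty]
    simpa using hj

lemma gardingCone_top_closure (n : ℕ) (hn : 2 ≤ n) :
    closure (GardingCone n n) = {lam : Fin n → ℝ | ∀ i, 0 ≤ lam i} := by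
  rw [gardingCone_top_eq n hn, closure_pi_set]
  ext x
  simp [Pi.le_def]

lemma gardingDual_top_eq (n : ℕ) (hn : 2 ≤ n) :
    GardingDual n n = {lam : Fin n → ℝ | ∀ i, 0 ≤ lam i} := by
  ext lam
  constructor
  · intro h i
    have hc : IsClosed {mu : Fin n → ℝ | 0 ≤ ∑ i, lam i * mu i} :=
      isClosed_le continuous_const (by fun_prop)
    have hsub : closure (GardingCone n n) ⊆ {mu : Fin n → ℝ | 0 ≤ ∑ i, lam i * mu i} :=
      closure_minimal h hc
    rw [gardingCone_top_closure n hn] at hsub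
    have := @hsub (Pi.single i 1) (fun j => by
      by_cases hj : j = i
      · subst hj; simp
      · simp [hj])
    simpa [Pi.single_apply] using this
  · intro h mu hmu
    rw [gardingCone_top_eq n hn] at hmu
    exact Finset.sum_nonneg fun i _ => mul_nonneg (h i) (le_of_lt (hmu i trivial))

lemma sigmaE_top {n : ℕ} (mu : Fin n → ℝ) : sigmaE n mu = ∏ i, mu i := by
  have h : Finset.powersetCard n (Finset.univ : Finset (Fin n)) = {Finset.univ} := by
    have := Finset.powersetCard_self (Finset.univ : Finset (Fin n))
    rwa [Finset.card_univ, Fintype.card_fin] at this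
  rw [sigmaE, h, Finset.sum_singleton]

lemma amgm_aux {n : ℕ} (hn : 2 ≤ n) (z : Fin n → ℝ) (hz : ∀ i, 0 ≤ z i) :
    (∏ i, z i) ^ ((1 : ℝ) / n) ≤ (∑ i, z i) / n := by
  have hn0 : (0 : ℝ) < n := by positivity
  have := Real.geom_mean_le_arith_mean Finset.univ (fun _ => (1 : ℝ)) z (by simp)
    (by simpa using (by omega : 0 < n)) (fun i _ => hz i)
  simpa using this

open Filter Topology in
lemma rhoStar_top (n : ℕ) (hn : 2 ≤ n) (lam : Fin n → ℝ) (hl : ∀ i, 0 ≤ lam i) :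
    rhoStar n n lam = (∏ i, lam i) ^ ((1 : ℝ) / n) := by
  have hn0 : (0 : ℝ) < n := by positivity
  have hlb : ∀ r ∈ {r : ℝ | ∃ mu : Fin n → ℝ, mu ∈ GardingCone n n ∧
      (n.choose n : ℝ) ≤ sigmaE n mu ∧ r = (∑ i, lam i * mu i) / n},
      (∏ i, lam i) ^ ((1 : ℝ) / n) ≤ r := by
    rintro r ⟨mu, hmu, h1, rfl⟩
    rw [gardingCone_top_eq n hn] at hmu
    rw [sigmaE_top, Nat.choose_self, Nat.cast_one] at h1
    refine le_trans ?_ (amgm_aux hn _ fun i => mul_nonneg (hl i) (le_of_lt (hmu i trivial)))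
    rw [Finset.prod_mul_distrib]
    have hp : 0 ≤ ∏ i, lam i := Finset.prod_nonneg fun i _ => hl i
    exact Real.rpow_le_rpow hp (le_mul_of_one_le_right hp h1) (by positivity)
  have hub : ∀ e : ℝ, 0 < e → rhoStar n n lam ≤ (∏ i, (lam i + e)) ^ ((1 : ℝ) / n) := by
    intro e he
    set G := (∏ i, (lam i + e)) ^ ((1 : ℝ) / n) with hG
    have hpos : ∀ i, 0 < lam i + e := fun i => by linarith [hl i]
    have hP : 0 < ∏ i, (lam i + e) := Finset.prod_pos fun i _ => hpos i
    have hGpos : 0 < G := Real.rpow_pos_of_pos hP _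
    have hGn : G ^ n = ∏ i, (lam i + e) := by
      rw [hG, one_div, Real.rpow_inv_natCast_pow hP.le (by omega)]
    have hmem : (∑ i, lam i * (G / (lam i + e))) / n ∈ {r : ℝ | ∃ mu : Fin n → ℝ,
        mu ∈ GardingCone n n ∧
        (n.choose n : ℝ) ≤ sigmaE n mu ∧ r = (∑ i, lam i * mu i) / n} := by
      refine ⟨fun i => G / (lam i + e), ?_, ?_, rfl⟩
      · rw [gardingCone_top_eq n hn]
        exact fun i _ => div_pos hGpos (hpos i)
      · rw [sigmaE_top, Nat.choose_self, Finset.prod_div_distrib, Finset.prod_const,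
          Finset.card_univ, Fintype.card_fin, hGn, div_self hP.ne', Nat.cast_one]
    refine (csInf_le ⟨_, hlb⟩ hmem).trans ?_
    rw [div_le_iff₀ hn0]
    calc ∑ i, lam i * (G / (lam i + e)) ≤ ∑ _i : Fin n, G := by
          refine Finset.sum_le_sum fun i _ => ?_
          rw [← mul_div_assoc, div_le_iff₀ (hpos i)]
          nlinarith
      _ = G * n := by simp [mul_comm]
  apply le_antisymm
  · have hcont : Continuous fun e : ℝ => (∏ i, (lam i + e)) ^ ((1 : ℝ) / n) :=
      Continuous.rpow_const (by fun_prop) fun _ => Or.inr (by positivity)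
    have ht : Tendsto (fun e : ℝ => (∏ i, (lam i + e)) ^ ((1 : ℝ) / n)) (𝓝[>] 0)
        (𝓝 ((∏ i, lam i) ^ ((1 : ℝ) / n))) := by
      have := (hcont.tendsto 0).mono_left (nhdsWithin_le_nhds (s := Set.Ioi 0))
      simpa using this
    refine ge_of_tendsto ht ?_
    filter_upwards [self_mem_nhdsWithin] with e he using hub e he
  · refine le_csInf ⟨_, fun _ => 1 , ?_, ?_, rfl⟩ hlb
    · rw [gardingCone_top_eq n hn]
      exact fun i _ => Set.mem_Ioi.2 one_pos
    · simp [sigmaE_top]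

/-- **The dual cone `Γ_n^*` and `ρ_n^*`** (Statement 16). `Γ_n^*` is the closed nonnegative
orthant, which is the closure of `Γ_n`, and for `λ ∈ Γ_n^*`,
`ρ_n^*(λ) = (λ_1⋯λ_n)^{1/n}`. -/
theorem gardingDual_top (n : ℕ) (hn : 2 ≤ n) :
    GardingDual n n = {lam : Fin n → ℝ | ∀ i, 0 ≤ lam i} ∧
    GardingDual n n = closure (GardingCone n n) ∧
    ∀ lam ∈ GardingDual n n, rhoStar n n lam = (∏ i, lam i) ^ ((1 : ℝ) / n) := by
  refine ⟨gardingDual_top_eq n hn, ?_, ?_⟩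
  · rw [gardingDual_top_eq n hn, gardingCone_top_closure n hn]
  · intro lam h
    rw [gardingDual_top_eq n hn] at h
    exact rhoStar_top n hn lam h
end
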